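/- arXiv:2604.01011 — 5 statements merged into one kernel-verified Lean document; each statement's English description precedes it below -/
import Mathlib

section
/- Let p be a prime and let G be a periodic residually finite p'-group admitting a splitting automorphism φ of order p such that for every g ∈ G the subgroup ⟨g, φ(g), φ²(g), …, φ^{p-1}(g)⟩ is nilpotent. Then G is nilpotent. -/
namespace Hig

section LieGraded

variable {R L : Type*} [CommRing R] [LieRing L] [LieAlgebra R L] {p : ℕ}

/-- Span of brackets of two submodules. -/
def mb (X Y : Submodule R L) : Submodule R L :=
  Submodule.map₂ ((LieModule.toEnd R L L : L →ₗ[R] Module.End R L)) X Y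

theorem mb_le {X Y Z : Submodule R L} : mb X Y ≤ Z ↔ ∀ x ∈ X, ∀ y ∈ Y, ⁅x, y⁆ ∈ Z := by
  unfold mb
  rw [Submodule.map₂_le]
  rfl

theorem mem_mb {X Y : Submodule R L} {x y : L} (hx : x ∈ X) (hy : y ∈ Y) : ⁅x, y⁆ ∈ mb X Y :=
  mb_le.1 le_rfl x hx y hy

theorem mb_mono {X X' Y Y' : Submodule R L} (h : X ≤ X') (h' : Y ≤ Y') : mb X Y ≤ mb X' Y' :=
  Submodule.map₂_le_map₂ h h'

theorem mb_bot_left (Y : Submodule R L) : mb ⊥ Y = ⊥ := Submodule.map₂_bot_left _ _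

theorem mb_bot_right (Y : Submodule R L) : mb Y ⊥ = ⊥ := Submodule.map₂_bot_right _ _

theorem mb_sup_left (X X' Y : Submodule R L) : mb (X ⊔ X') Y = mb X Y ⊔ mb X' Y :=
  Submodule.map₂_sup_left _ _ _ _

theorem mb_iSup_left {ι : Sort*} (X : ι → Submodule R L) (Y : Submodule R L) :
    mb (⨆ i, X i) Y = ⨆ i, mb (X i) Y :=
  Submodule.map₂_iSup_left _ _ _

theorem mb_iSup_right {ι : Sort*} (X : Submodule R L) (Y : ι → Submodule R L) :
    mb X (⨆ i, Y i) = ⨆ i, mb X (Y i) :=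
  Submodule.map₂_iSup_right _ _ _

theorem mb_mb_le {X Y Z W : Submodule R L} :
    mb (mb X Y) Z ≤ W ↔ ∀ x ∈ X, ∀ y ∈ Y, ∀ z ∈ Z, ⁅⁅x, y⁆, z⁆ ∈ W := by
  constructor
  · intro h x hx y hy z hz
    exact h (mem_mb (mem_mb hx hy) hz)
  · intro h
    refine mb_le.2 fun m hm z hz => ?_
    have : mb X Y ≤ W.comap ((LieModule.toEnd R L L : L →ₗ[R] Module.End R L).flip z) := by
      refine mb_le.2 fun x hx y hy => ?_
      exact h x hx y hy z hz
    exact this hm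

/-- Jacobi identity for submodules. -/
theorem mb_jacobi (X Y Z : Submodule R L) :
    mb (mb X Y) Z ≤ mb (mb X Z) Y ⊔ mb X (mb Y Z) := by
  refine mb_mb_le.2 fun x hx y hy z hz => ?_
  have : ⁅⁅x, y⁆, z⁆ = ⁅⁅x, z⁆, y⁆ + ⁅x, ⁅y, z⁆⁆ := by
    rw [lie_lie, leibniz_lie x y z, ← lie_skew y ⁅x, z⁆]; abel
  rw [this]
  exact Submodule.add_mem_sup (mem_mb (mem_mb hx hz) hy) (mem_mb hx (mem_mb hy hz))

/-- Graded bracket of two families. -/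
def gb (X Y : ZMod p → Submodule R L) : ZMod p → Submodule R L :=
  fun k => ⨆ i, mb (X i) (Y (k - i))

theorem gb_le {X Y Z : ZMod p → Submodule R L} :
    gb X Y ≤ Z ↔ ∀ i j, mb (X i) (Y j) ≤ Z (i + j) := by
  constructor
  · intro h i j
    refine le_trans ?_ (h (i + j))
    refine le_trans ?_ (le_iSup _ i)
    simp
  · intro h k
    refine iSup_le fun i => ?_
    have := h i (k - i)
    simpa using this

theorem le_gb (X Y : ZMod p → Submodule R L) (i j : ZMod p) :
    mb (X i) (Y j) ≤ gb X Y (i + j) := gb_le.1 le_rfl i j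

theorem gb_mono {X X' Y Y' : ZMod p → Submodule R L} (h : X ≤ X') (h' : Y ≤ Y') :
    gb X Y ≤ gb X' Y' :=
  gb_le.2 fun i j => (mb_mono (h i) (h' j)).trans (le_gb _ _ _ _)

theorem gb_bot_right (X : ZMod p → Submodule R L) : gb X ⊥ = ⊥ := by
  refine le_bot_iff.1 (gb_le.2 fun i j => ?_)
  simp [mb_bot_right]

theorem gb_bot_left (X : ZMod p → Submodule R L) : gb ⊥ X = ⊥ := by
  refine le_bot_iff.1 (gb_le.2 fun i j => ?_)
  simp [mb_bot_left]

theorem gb_jacobi (X Y Z : ZMod p → Submodule R L) :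
    gb (gb X Y) Z ≤ gb (gb X Z) Y ⊔ gb X (gb Y Z) := by
  refine gb_le.2 fun m k => ?_
  unfold gb
  rw [mb_iSup_left]
  refine iSup_le fun i => ?_
  refine (mb_jacobi _ _ _).trans ?_
  refine sup_le_sup ?_ ?_
  · have := (mb_mono (le_gb X Z i k) (le_refl (Y (m - i)))).trans (le_gb (gb X Z) Y _ _)
    have e : i + k + (m - i) = m + k := by ring
    rw [e] at this
    exact this
  · have := (mb_mono (le_refl (X i)) (le_gb Y Z (m - i) k)).trans (le_gb X (gb Y Z) _ _)
    have e : i + (m - i + k) = m + k := by ring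
    rw [e] at this
    exact this

/-- Derived family. -/
def der (D : ZMod p → Submodule R L) : ZMod p → Submodule R L := gb D D

theorem der_mono {D E : ZMod p → Submodule R L} (h : D ≤ E) : der D ≤ der E := gb_mono h h

theorem der_iter_le {D : ZMod p → Submodule R L} (h : der D ≤ D) (n : ℕ) : der^[n] D ≤ D := by
  induction n with
  | zero => exact le_rfl
  | succ n ih => rw [Function.iterate_succ_apply']; exact (der_mono ih).trans h

theorem der_iter_closed {D : ZMod p → Submodule R L} (h : der D ≤ D) (n : ℕ) :
    der (der^[n] D) ≤ der^[n] D := by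
  induction n with
  | zero => exact h
  | succ n ih => rw [Function.iterate_succ_apply']; exact der_mono ih

/-- Truncation. -/
def tr (k : ℕ) (D : ZMod p → Submodule R L) : ZMod p → Submodule R L :=
  fun s => if k ≤ s.val then D s else ⊥

/-- Graded subring generated by the components of index at least `k`. -/
def HS (k : ℕ) (D : ZMod p → Submodule R L) : ZMod p → Submodule R L :=
  sInf {E | tr k D ≤ E ∧ der E ≤ E}

theorem HS_le {k : ℕ} {D E : ZMod p → Submodule R L} (h : tr k D ≤ E) (h' : der E ≤ E) :
    HS k D ≤ E := sInf_le ⟨h, h'⟩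

theorem tr_le_HS (k : ℕ) (D : ZMod p → Submodule R L) : tr k D ≤ HS k D :=
  le_sInf fun _ h => h.1

theorem der_HS (k : ℕ) (D : ZMod p → Submodule R L) : der (HS k D) ≤ HS k D :=
  le_sInf fun _ h => (der_mono (HS_le h.1 h.2)).trans h.2

theorem HS_key (k : ℕ) (D : ZMod p → Submodule R L) (hD : der D ≤ D) (i j : ZMod p)
    {u v : L} (hu : u ∈ HS k D i) (hv : v ∈ D j) : ⁅u, v⁆ ∈ gb D (tr k D) (i + j) := by
  let E : ZMod p → Submodule R L := fun i =>
    { carrier := {u | u ∈ D i ∧ ∀ j, ∀ v ∈ D j, ⁅v, u⁆ ∈ gb D (tr k D) (j + i)}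
      zero_mem' := ⟨zero_mem _, by simp⟩
      add_mem' := fun {a b} ha hb => ⟨add_mem ha.1 hb.1, fun j v hv => by
        rw [lie_add]; exact add_mem (ha.2 j v hv) (hb.2 j v hv)⟩
      smul_mem' := fun c {a} ha => ⟨Submodule.smul_mem _ _ ha.1, fun j v hv => by
        rw [lie_smul]; exact Submodule.smul_mem _ _ (ha.2 j v hv)⟩ }
  have htr : tr k D ≤ D := by
    intro s; unfold tr; split_ifs
    · exact le_rfl
    · exact bot_le
  have hE : HS k D ≤ E := by
    refine HS_le ?_ ?_
    · intro s x hx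
      exact ⟨htr s hx, fun j v hv => le_gb _ _ _ _ (mem_mb hv hx)⟩
    · refine gb_le.2 fun a b => mb_le.2 fun x hx y hy => ⟨?_, ?_⟩
      · exact hD _ (le_gb _ _ _ _ (mem_mb hx.1 hy.1))
      · intro j v hv
        have e : ⁅v, ⁅x, y⁆⁆ = ⁅⁅v, x⁆, y⁆ - ⁅⁅v, y⁆, x⁆ := by
          rw [leibniz_lie, ← lie_skew x ⁅v, y⁆]; abel
        rw [e]
        refine sub_mem ?_ ?_
        · have := hy.2 (j + a) ⁅v, x⁆ (hD _ (le_gb _ _ _ _ (mem_mb hv hx.1)))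
          rwa [add_assoc] at this
        · have := hx.2 (j + b) ⁅v, y⁆ (hD _ (le_gb _ _ _ _ (mem_mb hv hy.1)))
          rwa [add_assoc, add_comm b a] at this
  have := (hE i hu).2 j v hv
  rw [← lie_skew, add_comm i j]
  exact neg_mem this

/-- Exponents in the theorem of Kreknin. -/
def KN : ℕ → ℕ
  | 0 => 0
  | m + 1 => KN m + (KN m + 1)

theorem kreknin_step [NeZero p] (m : ℕ) (D : ZMod p → Submodule R L) (hD : der D ≤ D)
    (h0 : D 0 = ⊥) : der^[KN m] D ≤ HS (m + 1) D := by
  induction m generalizing D with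
  | zero =>
    intro s
    by_cases hs : s = 0
    · subst hs; simp [KN, h0]
    · refine le_trans ?_ (tr_le_HS _ _ s)
      have : 1 ≤ s.val := Nat.one_le_iff_ne_zero.2 (by simpa using hs)
      simp [tr, this, KN]
  | succ m ih =>
    have hle : der^[KN m + 1] D ≤ D := der_iter_le hD _
    have h1 := ih (der^[KN m + 1] D) (der_iter_closed hD _)
      (le_bot_iff.1 ((hle 0).trans h0.le))
    rw [← Function.iterate_add_apply] at h1
    refine le_trans h1 (HS_le ?_ (der_HS _ _))
    intro s
    by_cases hs : m + 1 ≤ s.val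
    swap
    · simp [tr, hs]
    simp only [tr, hs, if_true]
    rcases hs.lt_or_eq with hs | hs
    · refine (hle s).trans (le_trans ?_ (tr_le_HS _ _ s))
      have : m + 1 + 1 ≤ s.val := hs
      simp [tr, this]
    · rw [Function.iterate_succ_apply']
      have h2 : der (der^[KN m] D) ≤ gb D (tr (m + 1) D) := by
        refine gb_le.2 fun i j => mb_le.2 fun u hu v hv => ?_
        exact HS_key _ _ hD _ _ (ih D hD h0 i hu) (der_iter_le hD _ j hv)
      refine (h2 s).trans ?_
      refine iSup_le fun a => ?_
      have hab : a + (s - a) = s := by ring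
      generalize s - a = b at hab
      by_cases hb : m + 1 ≤ b.val
      swap
      · simp [tr, hb, mb_bot_right]
      simp only [tr, hb, if_true]
      rcases hb.lt_or_eq with hb | hb
      · have hv : (a.val + b.val) % p = s.val := by rw [← ZMod.val_add, hab]
        have hbp := ZMod.val_lt b
        have hap := ZMod.val_lt a
        have ha : m + 1 < a.val := by
          by_contra hcon
          rcases lt_or_ge (a.val + b.val) p with h | h
          · rw [Nat.mod_eq_of_lt h] at hv; omega
          · rw [Nat.mod_eq_sub_mod h, Nat.mod_eq_of_lt (by omega)] at hv; omega
        have ha' : m + 1 + 1 ≤ a.val := ha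
        have hb' : m + 1 + 1 ≤ b.val := hb
        have e1 : D a ≤ HS (m + 1 + 1) D a := le_trans (by simp [tr, ha']) (tr_le_HS _ _ a)
        have e2 : D b ≤ HS (m + 1 + 1) D b := le_trans (by simp [tr, hb']) (tr_le_HS _ _ b)
        have := (mb_mono e1 e2).trans ((le_gb _ _ _ _).trans (der_HS (m + 1 + 1) D _))
        rwa [hab] at this
      · have : b = s := ZMod.val_injective p (by omega)
        have : a = 0 := by rw [this] at hab; simpa using hab
        rw [this, h0, mb_bot_left]; exact bot_le

theorem kreknin [NeZero p] (D : ZMod p → Submodule R L) (hD : der D ≤ D)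
    (h0 : D 0 = ⊥) : der^[KN p] D = ⊥ := by
  refine le_bot_iff.1 ((kreknin_step p D hD h0).trans (HS_le ?_ ?_))
  · intro s
    have : ¬ (p + 1 ≤ s.val) := by have := ZMod.val_lt s; omega
    simp [tr, this]
  · exact (gb_bot_left _).le

/-! ### nilpotency -/

open scoped Pointwise in
/-- Set of subset sums of a list. -/
def SS : List (ZMod p) → Finset (ZMod p)
  | [] => {0}
  | b :: l => {0, b} + SS l

open scoped Pointwise in
theorem SS_card (hp : p.Prime) (l : List (ZMod p)) (hl : ∀ b ∈ l, b ≠ 0) :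
    (SS l).Nonempty ∧ min p (l.length + 1) ≤ (SS l).card := by
  induction l with
  | nil => simp [SS]
  | cons b l ih =>
    obtain ⟨h1, h2⟩ := ih fun b hb => hl b (List.mem_cons_of_mem _ hb)
    have hb : b ≠ 0 := hl b List.mem_cons_self
    have := ZMod.cauchy_davenport hp (s := {0, b}) (t := SS l) (by simp) h1
    rw [Finset.card_pair hb.symm] at this
    refine ⟨Finset.Nonempty.add (by simp) h1, ?_⟩
    simp only [SS, List.length_cons]
    omega

theorem SS_univ (hp : p.Prime) (l : List (ZMod p)) (hl : ∀ b ∈ l, b ≠ 0)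
    (hlen : p ≤ l.length + 1) (a : ZMod p) : a ∈ SS l := by
  have : Fact p.Prime := ⟨hp⟩
  have h := (SS_card hp l hl).2
  rw [min_eq_left hlen] at h
  have : SS l = Finset.univ := by
    apply Finset.eq_univ_of_card
    rw [ZMod.card]
    exact le_antisymm ((Finset.card_le_univ _).trans (ZMod.card p).le) h
  simp [this]

/-- Iterated bracket with components of `D`. -/
def fb (D : ZMod p → Submodule R L) : Submodule R L → List (ZMod p) → Submodule R L
  | A, [] => A
  | A, b :: l => fb D (mb A (D b)) l

theorem fb_mono (D : ZMod p → Submodule R L) (l : List (ZMod p)) {A B : Submodule R L}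
    (h : A ≤ B) : fb D A l ≤ fb D B l := by
  induction l generalizing A B with
  | nil => exact h
  | cons b l ih => exact ih (mb_mono h le_rfl)

theorem fb_sup (D : ZMod p → Submodule R L) (l : List (ZMod p)) (A B : Submodule R L) :
    fb D (A ⊔ B) l = fb D A l ⊔ fb D B l := by
  induction l generalizing A B with
  | nil => rfl
  | cons b l ih => simp only [fb, mb_sup_left, ih]

theorem fb_bot (D : ZMod p → Submodule R L) (l : List (ZMod p)) :
    fb D ⊥ l = ⊥ := by
  induction l with
  | nil => rfl
  | cons b l ih => simp only [fb, mb_bot_left, ih]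

theorem fb_append_singleton (D : ZMod p → Submodule R L) (l : List (ZMod p)) (A : Submodule R L)
    (b : ZMod p) : fb D A (l ++ [b]) = mb (fb D A l) (D b) := by
  induction l generalizing A with
  | nil => rfl
  | cons c l ih => exact ih _

theorem fb_inv (D : ZMod p → Submodule R L) (l : List (ZMod p)) (Y : ZMod p → Submodule R L)
    (hY : gb Y D ≤ Y) (a : ZMod p) : fb D (Y a) l ≤ Y (a + l.sum) := by
  induction l generalizing a with
  | nil => simp [fb]
  | cons c l ih =>
    refine (fb_mono D l ((le_gb _ _ a c).trans (hY _))).trans ((ih _).trans ?_)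
    rw [List.sum_cons, add_assoc]

/-- Moving one entry to the end, modulo `Y`. -/
theorem fb_move (D X : ZMod p → Submodule R L) (hX : gb X D ≤ X)
    (Y : ZMod p → Submodule R L) (hY : gb Y D ≤ Y) (hXY : gb X (der D) ≤ Y)
    (l : List (ZMod p)) (A : Submodule R L) (a b : ZMod p) (hA : A ≤ X a) :
    fb D A (b :: l) ≤ mb (fb D A l) (D b) ⊔ Y (a + (b :: l).sum) := by
  induction l generalizing A a with
  | nil => exact le_sup_left
  | cons c l ih =>
    have h1 : fb D A (b :: c :: l) ≤ fb D (mb (mb A (D c)) (D b) ⊔ Y (a + (b + c))) l := by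
      refine fb_mono D l ((mb_jacobi _ _ _).trans (sup_le_sup le_rfl ?_))
      exact (mb_mono hA (le_gb D D b c)).trans ((le_gb X (der D) _ _).trans (hXY _))
    refine h1.trans ?_
    rw [fb_sup]
    refine sup_le ?_ ((fb_inv D l Y hY _).trans (le_trans ?_ le_sup_right))
    · have := ih (mb A (D c)) (a + c) ((mb_mono hA le_rfl).trans ((le_gb _ _ _ _).trans (hX _)))
      have e : a + c + (b :: l).sum = a + (b :: c :: l).sum := by simp; ring
      rw [e] at this
      exact this
    · have e : a + (b + c) + l.sum = a + (b :: c :: l).sum := by simp; ring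
      rw [e]

theorem fb_zero (D X : ZMod p → Submodule R L) (hX : gb X D ≤ X) (h0 : X 0 = ⊥)
    (Y : ZMod p → Submodule R L) (hY : gb Y D ≤ Y) (hXY : gb X (der D) ≤ Y)
    (l : List (ZMod p)) (A : Submodule R L) (a : ZMod p) (hA : A ≤ X a) (hl : -a ∈ SS l) :
    fb D A l ≤ Y (a + l.sum) := by
  induction l generalizing A a with
  | nil =>
    have : a = 0 := by simpa [SS] using hl
    subst this
    rw [h0] at hA
    exact hA.trans bot_le
  | cons b l ih =>
    obtain ⟨u, hu, v, hv, huv⟩ := Finset.mem_add.1 hl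
    rcases Finset.mem_insert.1 hu with rfl | hu
    · refine (fb_move D X hX Y hY hXY l A a b hA).trans (sup_le ?_ le_rfl)
      rw [zero_add] at huv
      have := (mb_mono (ih A a hA (huv ▸ hv)) (le_refl (D b))).trans ((le_gb Y D _ _).trans (hY _))
      have e : a + l.sum + b = a + (b :: l).sum := by simp; ring
      rwa [e] at this
    · rw [Finset.mem_singleton] at hu
      subst hu
      have := ih (mb A (D u)) (a + u)
        ((mb_mono hA le_rfl).trans ((le_gb _ _ _ _).trans (hX _))) (by
          have : -(a + u) = v := by
            rw [neg_add, ← huv]; ring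
          rwa [this])
      rwa [add_assoc, ← List.sum_cons] at this

theorem iter_le_fb (D X : ZMod p → Submodule R L) (r : ℕ) (k : ZMod p) :
    (fun Z => gb Z D)^[r] X k ≤
      ⨆ a, ⨆ l : {l : List (ZMod p) // l.length = r ∧ a + l.sum = k}, fb D (X a) l := by
  induction r generalizing k with
  | zero =>
    refine le_trans ?_ (le_iSup _ k)
    exact le_iSup (fun l : {l : List (ZMod p) // l.length = 0 ∧ k + l.sum = k} => fb D (X k) l)
      ⟨[], rfl, by simp⟩
  | succ r ih =>
    rw [Function.iterate_succ_apply']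
    refine iSup_le fun i => ?_
    refine (mb_mono (ih i) le_rfl).trans ?_
    rw [mb_iSup_left]
    refine iSup_mono fun a => ?_
    rw [mb_iSup_left]
    refine iSup_le fun l => ?_
    rw [← fb_append_singleton]
    exact le_iSup (fun l : {l : List (ZMod p) // l.length = r + 1 ∧ a + l.sum = k} => fb D (X a) l)
      ⟨l ++ [k - i], by simp [l.2.1], by
        have := l.2.2
        rw [List.sum_append, ← add_assoc, this]; simp⟩

/-- If some entry is zero, then the iterated bracket is zero. -/
theorem fb_of_zero_mem (D : ZMod p → Submodule R L) (h0 : D 0 = ⊥) (l : List (ZMod p))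
    (A : Submodule R L) (h : (0 : ZMod p) ∈ l) : fb D A l = ⊥ := by
  induction l generalizing A with
  | nil => simp at h
  | cons b l ih =>
    rcases List.mem_cons.1 h with h | h
    · subst h; simp only [fb, h0, mb_bot_right, fb_bot]
    · exact ih _ h

theorem metab (hp : p.Prime) (D X : ZMod p → Submodule R L) (hD0 : D 0 = ⊥)
    (hX : gb X D ≤ X) (h0 : X 0 = ⊥)
    (Y : ZMod p → Submodule R L) (hY : gb Y D ≤ Y) (hXY : gb X (der D) ≤ Y) :
    (fun Z => gb Z D)^[p] X ≤ Y := by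
  intro k
  refine (iter_le_fb D X p k).trans (iSup_le fun a => iSup_le fun l => ?_)
  obtain ⟨l, hl, hk⟩ := l
  by_cases hz : (0 : ZMod p) ∈ l
  · simp [fb_of_zero_mem D hD0 l _ hz]
  · have := fb_zero D X hX h0 Y hY hXY l (X a) a le_rfl
      (SS_univ hp l (fun b hb h => hz (h ▸ hb)) (by omega) _)
    rwa [hk] at this

theorem nilp_aux (hp : p.Prime) (d : ℕ) (D M : ZMod p → Submodule R L) (hD : der D ≤ D)
    (hD0 : D 0 = ⊥) (hM : gb M D ≤ M) (hM0 : M 0 = ⊥) (hd : der^[d] D = ⊥) :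
    (fun Z => gb Z D)^[p ^ d] M = ⊥ := by
  induction d generalizing D M with
  | zero =>
    have : D = ⊥ := hd
    subst this
    rw [pow_zero, Function.iterate_one]
    exact gb_bot_right M
  | succ d ih =>
    have hc := ih (der D) M (der_mono hD) (le_bot_iff.1 ((hD 0).trans hD0.le))
      ((gb_mono le_rfl hD).trans hM) hM0 (by rw [← Function.iterate_succ_apply]; exact hd)
    have hchain : ∀ r, gb ((fun Z => gb Z (der D))^[r] M) D ≤ (fun Z => gb Z (der D))^[r] M ∧
        (fun Z => gb Z (der D))^[r] M ≤ M ∧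
        (fun Z => gb Z D)^[p * r] M ≤ (fun Z => gb Z (der D))^[r] M := by
      intro r
      induction r with
      | zero =>
        rw [Nat.mul_zero]
        simp only [Function.iterate_zero, id_eq]
        exact ⟨hM, le_rfl, le_rfl⟩
      | succ r ihr =>
        obtain ⟨h1, h2, h3⟩ := ihr
        rw [Function.iterate_succ_apply']
        set N := (fun Z => gb Z (der D))^[r] M
        have g1 : gb (gb N (der D)) D ≤ gb N (der D) := by
          refine (gb_jacobi _ _ _).trans (sup_le ?_ ?_)
          · exact gb_mono h1 le_rfl
          · refine gb_mono le_rfl (gb_mono hD le_rfl)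
        refine ⟨g1, ?_, ?_⟩
        · exact (gb_mono h2 hD).trans hM
        · have e : p * (r + 1) = p + p * r := by ring
          rw [e, Function.iterate_add_apply]
          have hmono : Monotone (fun Z : ZMod p → Submodule R L => gb Z D) :=
            fun _ _ h => gb_mono h le_rfl
          refine (hmono.iterate p h3).trans ?_
          exact metab hp D N hD0 h1 (le_bot_iff.1 ((h2 0).trans hM0.le)) _ g1 le_rfl
    have := (hchain (p ^ d)).2.2
    rw [hc] at this
    rw [pow_succ']
    exact le_bot_iff.1 this

/-- Ungraded lower central series. -/
def lcs (R L : Type*) [CommRing R] [LieRing L] [LieAlgebra R L] : ℕ → Submodule R L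
  | 0 => ⊤
  | r + 1 => mb (lcs R L r) ⊤

/-- Theorem of Higman, Kreknin and Kostrikin. -/
theorem higman (hp : p.Prime) (D : ZMod p → Submodule R L) (hD : der D ≤ D)
    (hD0 : D 0 = ⊥) (htop : ⨆ i, D i = ⊤) : lcs R L (p ^ KN p) = ⊥ := by
  have : NeZero p := ⟨hp.ne_zero⟩
  have h := nilp_aux hp _ D D hD hD0 hD hD0 (kreknin D hD hD0)
  have key : ∀ r, lcs R L r ≤ ⨆ k, (fun Z => gb Z D)^[r] D k := by
    intro r
    induction r with
    | zero => exact htop.ge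
    | succ r ih =>
      rw [Function.iterate_succ_apply']
      refine (mb_mono ih htop.ge).trans ?_
      rw [mb_iSup_left]
      refine iSup_le fun i => ?_
      rw [mb_iSup_right]
      refine iSup_le fun j => ?_
      exact (le_gb _ _ _ _).trans (le_iSup (fun k => gb ((fun Z => gb Z D)^[r] D) D k) (i + j))
  refine le_bot_iff.1 ((key _).trans ?_)
  rw [h]
  simp

end LieGraded
end Hig

namespace Hig

section Eigen

theorem higman_eigen {A B : Type*} [CommRing A] [IsDomain A] [LieRing B] [LieAlgebra A B]
    {p : ℕ} (hp : p.Prime) (w : A) (hw : IsPrimitiveRoot w p) (F : B →ₗ[A] B)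
    (hbr : ∀ x y, F ⁅x, y⁆ = ⁅F x, F y⁆)
    (hsum : ∀ x, ∑ j ∈ Finset.range p, (F ^ j) x = 0)
    (htor : ∀ x : B, ∃ m : ℕ, m.Coprime p ∧ m • x = 0) : lcs A B (p ^ KN p) = ⊥ := by
  have hne : NeZero p := ⟨hp.ne_zero⟩
  have htf : ∀ x : B, p • x = 0 → x = 0 := by
    intro x hx
    obtain ⟨m, hm, hmx⟩ := htor x
    have h1 := addOrderOf_dvd_of_nsmul_eq_zero hx
    have h2 := addOrderOf_dvd_of_nsmul_eq_zero hmx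
    have := Nat.dvd_gcd h2 h1
    rw [Nat.Coprime.gcd_eq_one hm, Nat.dvd_one] at this
    exact AddMonoid.addOrderOf_eq_one_iff.1 this
  have hFp : ∀ x, (F ^ p) x = x := by
    intro x
    have h1 := Finset.sum_range_succ (fun j => (F ^ j) x) p
    have h2 := Finset.sum_range_succ' (fun j => (F ^ j) x) p
    have h3 : ∑ j ∈ Finset.range p, (F ^ (j + 1)) x = 0 := by
      have := congrArg F (hsum x)
      rw [map_sum, map_zero] at this
      simpa only [pow_succ', Module.End.mul_apply] using this
    rw [hsum, zero_add] at h1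
    rw [h3, h1] at h2
    simpa using h2
  have hwp : ∀ a b : ℕ, a % p = b % p → w ^ a = w ^ b := by
    intro a b h
    rw [pow_eq_pow_mod a hw.pow_eq_one, pow_eq_pow_mod b hw.pow_eq_one, h]
  let D : ZMod p → Submodule A B := fun i => LinearMap.ker ((w ^ i.val) • F - LinearMap.id)
  have hmem : ∀ i x, x ∈ D i ↔ w ^ i.val • F x = x := by
    intro i x
    simp only [D, LinearMap.mem_ker, LinearMap.sub_apply, LinearMap.smul_apply,
      LinearMap.id_apply, sub_eq_zero]
  refine higman hp D ?_ ?_ ?_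
  · refine gb_le.2 fun i j => mb_le.2 fun x hx y hy => ?_
    rw [hmem] at hx hy ⊢
    rw [hwp (i + j).val (i.val + j.val) (by rw [ZMod.val_add, Nat.mod_mod]), pow_add, hbr]
    conv_rhs => rw [← hx, ← hy]
    rw [smul_lie, lie_smul, smul_smul]
  · refine le_bot_iff.1 fun x hx => ?_
    rw [hmem] at hx
    simp only [ZMod.val_zero, pow_zero, one_smul] at hx
    have h1 : ∀ j : ℕ, (F ^ j) x = x := by
      intro j
      induction j with
      | zero => simp
      | succ j ih => rw [pow_succ, Module.End.mul_apply, hx, ih]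
    have := hsum x
    simp only [h1, Finset.sum_const, Finset.card_range] at this
    exact htf x this
  · rw [eq_top_iff]
    intro y _
    -- `y` is divisible by `p`
    obtain ⟨x, rfl⟩ : ∃ x, p • x = y := by
      obtain ⟨m, hm, hmy⟩ := htor y
      have hb := Nat.gcd_eq_gcd_ab m p
      rw [Nat.Coprime.gcd_eq_one hm] at hb
      refine ⟨(Nat.gcdB m p) • y, ?_⟩
      have h1 : ((1 : ℕ) : ℤ) • y = y := by simp
      rw [hb, add_smul, mul_comm (m : ℤ), mul_smul, natCast_zsmul, hmy, smul_zero, zero_add,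
        mul_smul, natCast_zsmul] at h1
      exact h1
    have hx : p • x = ∑ i : ZMod p, ∑ j ∈ Finset.range p, w ^ (i.val * j) • (F ^ j) x := by
      rw [Finset.sum_comm]
      simp only [← Finset.sum_smul]
      rw [Finset.sum_eq_single_of_mem 0 (by simp [hp.pos])]
      · simp [ZMod.card, Nat.cast_smul_eq_nsmul]
      · intro j hj hj0
        have hj : j < p := Finset.mem_range.1 hj
        have hprim : IsPrimitiveRoot (w ^ j) p :=
          hw.pow_of_coprime j ((Nat.coprime_of_lt_prime hj0 hj hp).symm)
        have := hprim.geom_sum_eq_zero hp.one_lt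
        have h2 : ∑ i : ZMod p, w ^ (i.val * j) = ∑ i ∈ Finset.range p, (w ^ j) ^ i := by
          refine Finset.sum_bij (fun i _ => i.val) ?_ ?_ ?_ ?_
          · intro i _; simpa using ZMod.val_lt i
          · intro a _ b _ h; exact ZMod.val_injective p h
          · intro b hb
            exact ⟨(b : ZMod p), Finset.mem_univ _, ZMod.val_cast_of_lt (Finset.mem_range.1 hb)⟩
          · intro i _; rw [← pow_mul, mul_comm]
        rw [h2, this, zero_smul]
    rw [hx]
    refine Submodule.sum_mem _ fun i _ => ?_
    refine Submodule.mem_iSup_of_mem i ?_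
    rw [hmem, map_sum, Finset.smul_sum]
    have h1 := Finset.sum_range_succ (fun j => w ^ (i.val * j) • (F ^ j) x) p
    have h2 := Finset.sum_range_succ' (fun j => w ^ (i.val * j) • (F ^ j) x) p
    rw [h1] at h2
    have e1 : w ^ (i.val * p) • (F ^ p) x = x := by
      rw [hFp, mul_comm, pow_mul, hw.pow_eq_one, one_pow, one_smul]
    simp only [e1, mul_zero, pow_zero, one_smul, Module.End.one_apply] at h2
    rw [add_right_cancel h2]
    refine Finset.sum_congr rfl fun j _ => ?_
    rw [map_smul, smul_smul, ← pow_add, pow_succ', Module.End.mul_apply]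
    congr 2
    ring

open scoped TensorProduct

/-- Theorem of Higman for Lie rings. -/
theorem higman_int {L : Type*} [LieRing L]
    {p : ℕ} (hp : p.Prime) (f : L →ₗ[ℤ] L)
    (hbr : ∀ x y, f ⁅x, y⁆ = ⁅f x, f y⁆)
    (hsum : ∀ x, ∑ j ∈ Finset.range p, (f ^ j) x = 0)
    (htor : ∀ x : L, ∃ m : ℕ, m.Coprime p ∧ m • x = 0) : lcs ℤ L (p ^ KN p) = ⊥ := by
  have hne : NeZero p := ⟨hp.ne_zero⟩
  have hneq : NeZero (p : ℚ) := ⟨by exact_mod_cast hp.ne_zero⟩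
  let K := CyclotomicField p ℚ
  have : IsCyclotomicExtension {p} ℚ K := CyclotomicField.isCyclotomicExtension p ℚ
  let A := NumberField.RingOfIntegers K
  let w : A := (IsCyclotomicExtension.zeta_spec p ℚ K).toInteger
  have hw : IsPrimitiveRoot w p := (IsCyclotomicExtension.zeta_spec p ℚ K).toInteger_isPrimitiveRoot
  have main : lcs A (A ⊗[ℤ] L) (p ^ KN p) = ⊥ := by
    have hpow : ∀ j : ℕ, ∀ a : A, ∀ x : L,
        ((f.baseChange A) ^ j) (a ⊗ₜ[ℤ] x) = a ⊗ₜ[ℤ] (f ^ j) x := by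
      intro j
      induction j with
      | zero => intro a x; simp
      | succ j ih =>
        intro a x
        rw [pow_succ, Module.End.mul_apply, LinearMap.baseChange_tmul, ih, pow_succ,
          Module.End.mul_apply]
    refine higman_eigen hp w hw (f.baseChange A) ?_ ?_ ?_
    · intro x y
      induction x using TensorProduct.induction_on with
      | zero => simp
      | add x x' hx hx' => simp only [add_lie, map_add, hx, hx']
      | tmul a x =>
        induction y using TensorProduct.induction_on with
        | zero => simp
        | add x x' hx hx' => simp only [lie_add, map_add, hx, hx']
        | tmul b y => simp [hbr]
    · intro x
      induction x using TensorProduct.induction_on with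
      | zero => simp
      | add x x' hx hx' => simp only [map_add, Finset.sum_add_distrib, hx, hx', add_zero]
      | tmul a x =>
        simp only [hpow, ← TensorProduct.tmul_sum, hsum, TensorProduct.tmul_zero]
    · intro x
      induction x using TensorProduct.induction_on with
      | zero => exact ⟨1, by simp, by simp⟩
      | add x x' hx hx' =>
        obtain ⟨m, h1, h2⟩ := hx
        obtain ⟨n, h3, h4⟩ := hx'
        refine ⟨m * n, Nat.Coprime.mul_left h1 h3, ?_⟩
        rw [smul_add, mul_smul m n x', h4, mul_comm, mul_smul n m x, h2, smul_zero, smul_zero,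
          add_zero]
      | tmul a x =>
        obtain ⟨m, h1, h2⟩ := htor x
        refine ⟨m, h1, ?_⟩
        rw [TensorProduct.smul_tmul', TensorProduct.smul_tmul, h2, TensorProduct.tmul_zero]
  have hincl : ∀ r, ∀ x ∈ lcs ℤ L r, (1 : A) ⊗ₜ[ℤ] x ∈ lcs A (A ⊗[ℤ] L) r := by
    intro r
    induction r with
    | zero => intro x _; trivial
    | succ r ih =>
      have : lcs ℤ L (r + 1) ≤
          ((lcs A (A ⊗[ℤ] L) (r + 1)).restrictScalars ℤ).comap (TensorProduct.mk ℤ A L 1) := by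
        refine mb_le.2 fun x hx y _ => ?_
        have := mem_mb (ih x hx) (Submodule.mem_top (R := A) (x := (1 : A) ⊗ₜ[ℤ] y))
        rw [LieAlgebra.ExtendScalars.bracket_tmul, mul_one] at this
        exact this
      exact fun x hx => this hx
  refine le_bot_iff.1 fun x hx => ?_
  have h1 := hincl _ x hx
  rw [main, Submodule.mem_bot] at h1
  have hinj := Module.FaithfullyFlat.tensorProduct_mk_injective (A := ℤ) (B := A) L
  exact hinj (by simpa using h1)

end Eigen
end Hig

namespace Hig

section GroupLie

open scoped commutatorElement

variable (G : Type*) [Group G]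

/-- Lower central series, indexed from `1`. -/
def Ga (n : ℕ) : Subgroup G := (⊤ : Subgroup G).lowerCentralSeries (n - 1)

instance Ga_normal (n : ℕ) : (Ga G n).Normal := by unfold Ga; infer_instance

variable {G}

theorem three_sub {H₁ H₂ H₃ : Subgroup G} (K : Subgroup G) [K.Normal]
    (h1 : ⁅⁅H₂, H₃⁆, H₁⁆ ≤ K) (h2 : ⁅⁅H₃, H₁⁆, H₂⁆ ≤ K) : ⁅⁅H₁, H₂⁆, H₃⁆ ≤ K := by
  have key : ∀ H : Subgroup G, H ≤ K ↔ H.map (QuotientGroup.mk' K) = ⊥ := by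
    intro H
    rw [Subgroup.map_eq_bot_iff, QuotientGroup.ker_mk']
  rw [key] at h1 h2 ⊢
  simp only [Subgroup.map_commutator] at h1 h2 ⊢
  exact Subgroup.commutator_commutator_eq_bot_of_rotate h1 h2

theorem lcs_comm_le (m n : ℕ) :
    ⁅(⊤ : Subgroup G).lowerCentralSeries m, (⊤ : Subgroup G).lowerCentralSeries n⁆ ≤
      (⊤ : Subgroup G).lowerCentralSeries (m + n + 1) := by
  induction n generalizing m with
  | zero => exact le_rfl
  | succ n ih =>
    rw [Subgroup.commutator_comm, Subgroup.lowerCentralSeries_succ]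
    refine three_sub _ ?_ ?_
    · rw [Subgroup.commutator_comm ⊤, ← Subgroup.lowerCentralSeries_succ]
      refine (ih (m + 1)).trans (le_of_eq ?_)
      congr 1; ring
    · exact (Subgroup.commutator_mono (ih m) le_rfl).trans le_rfl

theorem Ga_comm (i j : ℕ) {x y : G} (hx : x ∈ Ga G i) (hy : y ∈ Ga G j) :
    ⁅x, y⁆ ∈ Ga G (i + j) := by
  have h := lcs_comm_le (i - 1) (j - 1) (Subgroup.commutator_mem_commutator hx hy)
  exact Subgroup.lowerCentralSeries_antitone _ (by omega) h

theorem Ga_comm_top (i : ℕ) {x : G} (hx : x ∈ Ga G i) (y : G) :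
    ⁅x, y⁆ ∈ Ga G (i + 1) := Ga_comm i 1 hx (by simp [Ga])

theorem Ga_succ_le (i : ℕ) : Ga G (i + 1) ≤ Ga G i :=
  Subgroup.lowerCentralSeries_antitone _ (by omega)

variable (G) in
/-- Factors of the lower central series. -/
abbrev GQ (n : ℕ) := ↥(Ga G n) ⧸ (Ga G (n + 1)).subgroupOf (Ga G n)

/-- Class of an element. -/
def qc (n : ℕ) (g : G) (h : g ∈ Ga G n) : GQ G n := QuotientGroup.mk ⟨g, h⟩

theorem qc_eq_iff (n : ℕ) {g g' : G} (h : g ∈ Ga G n) (h' : g' ∈ Ga G n) :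
    qc n g h = qc n g' h' ↔ g⁻¹ * g' ∈ Ga G (n + 1) := by
  unfold qc
  rw [QuotientGroup.eq]
  rfl

theorem qc_mul (n : ℕ) {g g' : G} (h : g ∈ Ga G n) (h' : g' ∈ Ga G n) :
    qc n (g * g') (mul_mem h h') = qc n g h * qc n g' h' := rfl

theorem qc_one (n : ℕ) : qc n (1 : G) (one_mem _) = 1 := rfl

theorem qc_eq_one (n : ℕ) {g : G} (h : g ∈ Ga G n) (h' : g ∈ Ga G (n + 1)) : qc n g h = 1 := by
  rw [← qc_one, qc_eq_iff, mul_one]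
  exact inv_mem h'

theorem qc_surj (n : ℕ) (a : GQ G n) : ∃ g h, a = qc n g h := by
  induction a using QuotientGroup.induction_on with
  | H z => exact ⟨z.1, z.2, rfl⟩

instance GQ_comm (n : ℕ) : CommGroup (GQ G n) :=
  { (inferInstance : Group (GQ G n)) with
    mul_comm := fun a b => by
      obtain ⟨x, hx, rfl⟩ := qc_surj n a
      obtain ⟨y, hy, rfl⟩ := qc_surj n b
      rw [← qc_mul, ← qc_mul, qc_eq_iff]
      have := Ga_comm_top n (inv_mem hy) x⁻¹
      rw [commutatorElement_def] at this
      simpa [mul_assoc] using this }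

theorem qc_conj (n : ℕ) (x : G) {g : G} (h : g ∈ Ga G n) (h' : x * g * x⁻¹ ∈ Ga G n) :
    qc n (x * g * x⁻¹) h' = qc n g h := by
  symm
  rw [qc_eq_iff]
  have := Ga_comm_top n (inv_mem h) x
  rw [commutatorElement_def] at this
  simpa [mul_assoc] using this

theorem qc_congr (n : ℕ) {g g' : G} (e : g = g') (h : g ∈ Ga G n) (h' : g' ∈ Ga G n) :
    qc n g h = qc n g' h' := by subst e; rfl

theorem qc_comm_mul_left (i j : ℕ) {x x' y : G} (hx : x ∈ Ga G i) (hx' : x' ∈ Ga G i)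
    (hy : y ∈ Ga G j) :
    qc (i + j) ⁅x * x', y⁆ (Ga_comm i j (mul_mem hx hx') hy) =
      qc (i + j) ⁅x, y⁆ (Ga_comm i j hx hy) * qc (i + j) ⁅x', y⁆ (Ga_comm i j hx' hy) := by
  have h1 := Ga_comm i j hx hy
  have h2 := Ga_comm i j hx' hy
  have h3 := (Ga_normal G (i + j)).conj_mem _ h2 x
  rw [qc_congr _ (commutatorElement_mul_left_eq_conj_mul x x' y) _ (mul_mem h3 h1),
    qc_mul _ h3 h1, qc_conj _ _ h2, mul_comm]

theorem qc_comm_mul_right (i j : ℕ) {x y y' : G} (hx : x ∈ Ga G i) (hy : y ∈ Ga G j)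
    (hy' : y' ∈ Ga G j) :
    qc (i + j) ⁅x, y * y'⁆ (Ga_comm i j hx (mul_mem hy hy')) =
      qc (i + j) ⁅x, y⁆ (Ga_comm i j hx hy) * qc (i + j) ⁅x, y'⁆ (Ga_comm i j hx hy') := by
  have h1 := Ga_comm i j hx hy
  have h2 := Ga_comm i j hx hy'
  have h3 := (Ga_normal G (i + j)).conj_mem _ h2 y
  have e : ⁅x, y * y'⁆ = ⁅x, y⁆ * (y * ⁅x, y'⁆ * y⁻¹) := by
    rw [commutatorElement_mul_right_eq_mul_conj]; simp only [mul_assoc]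
  rw [qc_congr _ e _ (mul_mem h1 h3), qc_mul _ h1 h3, qc_conj _ _ h2]

/-- The bracket on the factors: inner map. -/
def bq1 (i j : ℕ) (x : Ga G i) : GQ G j →* GQ G (i + j) :=
  QuotientGroup.lift _
    { toFun := fun y => qc (i + j) ⁅(x : G), (y : G)⁆ (Ga_comm i j x.2 y.2)
      map_one' := qc_eq_one _ _ (by simp)
      map_mul' := fun y y' => qc_comm_mul_right i j x.2 y.2 y'.2 } (by
    intro y hy
    exact qc_eq_one _ _ (Ga_comm i (j + 1) x.2 hy))

/-- The bracket on the factors. -/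
def bq (i j : ℕ) : GQ G i →* GQ G j →* GQ G (i + j) :=
  QuotientGroup.lift _
    { toFun := bq1 i j
      map_one' := by
        ext y
        exact qc_eq_one _ _ (by simp)
      map_mul' := fun x x' => by
        ext y
        exact qc_comm_mul_left i j x.2 x'.2 y.2 } (by
    intro x hx
    ext y
    refine qc_eq_one _ _ ?_
    have := Ga_comm (i + 1) j hx y.2
    rwa [add_right_comm] at this)

theorem bq_qc (i j : ℕ) {x y : G} (hx : x ∈ Ga G i) (hy : y ∈ Ga G j) :
    bq i j (qc i x hx) (qc j y hy) = qc (i + j) ⁅x, y⁆ (Ga_comm i j hx hy) := rfl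

variable (G) in
/-- Additive version of the factors. -/
abbrev GA (n : ℕ) := Additive (GQ G n)

instance GA_ring : DirectSum.GNonUnitalNonAssocSemiring (GA G) where
  mul {i j} a b := Additive.ofMul (bq i j a.toMul b.toMul)
  mul_zero {i j} a := by
    change Additive.ofMul (bq i j a.toMul 1) = 0
    rw [map_one]; rfl
  zero_mul {i j} a := by
    change Additive.ofMul (bq i j 1 a.toMul) = 0
    rw [map_one]; rfl
  mul_add {i j} a b c := by
    change Additive.ofMul (bq i j a.toMul (b.toMul * c.toMul)) = _
    rw [map_mul]; rfl
  add_mul {i j} a b c := by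
    change Additive.ofMul (bq i j (a.toMul * b.toMul) c.toMul) = _
    rw [map_mul]; rfl

variable (G) in
/-- The associated Lie ring of a group. -/
def LR := DirectSum ℕ (GA G)

instance : AddCommGroup (LR G) := inferInstanceAs (AddCommGroup (DirectSum ℕ (GA G)))

/-- Class of an element in the Lie ring. -/
def cl (n : ℕ) (g : G) (h : g ∈ Ga G n) : LR G :=
  DirectSum.of (GA G) n (Additive.ofMul (qc n g h))

theorem cl_mul (n : ℕ) {g g' : G} (h : g ∈ Ga G n) (h' : g' ∈ Ga G n) :
    cl n (g * g') (mul_mem h h') = cl n g h + cl n g' h' := by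
  unfold cl
  rw [qc_mul, ofMul_mul, map_add]
  rfl

theorem cl_congr {n m : ℕ} (e : n = m) {g g' : G} (e' : g = g') (h : g ∈ Ga G n)
    (h' : g' ∈ Ga G m) : cl n g h = cl m g' h' := by subst e e'; rfl

theorem cl_one (n : ℕ) : cl n (1 : G) (one_mem _) = 0 := by
  unfold cl
  rw [qc_one, ofMul_one, map_zero]
  rfl

theorem cl_conj (n : ℕ) (x : G) {g : G} (h : g ∈ Ga G n) :
    cl n (x * g * x⁻¹) ((Ga_normal G n).conj_mem _ h x) = cl n g h := by
  unfold cl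
  rw [qc_conj _ _ h]

theorem cl_inv (n : ℕ) {g : G} (h : g ∈ Ga G n) : cl n g⁻¹ (inv_mem h) = - cl n g h := by
  rw [eq_neg_iff_add_eq_zero, ← cl_mul, ← cl_one n]
  exact cl_congr rfl (by simp) _ _

theorem cl_eq_zero (n : ℕ) {g : G} (h : g ∈ Ga G n) (h0 : cl n g h = 0) : g ∈ Ga G (n + 1) := by
  have h1 : Additive.ofMul (qc n g h) = 0 := by
    have := DirectSum.of_injective (β := GA G) n
    apply this
    rw [map_zero]
    exact h0
  have h2 : qc n g h = qc n 1 (one_mem _) := h1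
  have := (qc_eq_iff n _ _).1 h2.symm
  simpa using this

theorem LR_ind {P : LR G → Prop} (h0 : P 0) (hadd : ∀ x y, P x → P y → P (x + y))
    (hcl : ∀ n g h, P (cl n g h)) (x : LR G) : P x := by
  refine DirectSum.induction_on (β := GA G) x h0 ?_ hadd
  intro i a
  obtain ⟨g, h, e⟩ := qc_surj i a.toMul
  have := hcl i g h
  unfold cl at this
  rw [← e] at this
  exact this

/-- The bracket as a biadditive map. -/
def lb : LR G →+ LR G →+ LR G := DirectSum.mulHom (GA G)

theorem lb_cl (i j : ℕ) {x y : G} (hx : x ∈ Ga G i) (hy : y ∈ Ga G j) :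
    lb (cl i x hx) (cl j y hy) = cl (i + j) ⁅x, y⁆ (Ga_comm i j hx hy) := by
  exact DirectSum.mulHom_of_of _ _

theorem lb_skew (x y : LR G) : lb x y + lb y x = 0 := by
  induction x using LR_ind with
  | h0 => simp
  | hadd x x' hx hx' =>
    rw [map_add, map_add, AddMonoidHom.add_apply, add_add_add_comm, hx, hx', add_zero]
  | hcl i g hg =>
    induction y using LR_ind with
    | h0 => simp
    | hadd x x' hx hx' =>
      rw [map_add, map_add, AddMonoidHom.add_apply, add_add_add_comm, hx, hx', add_zero]
    | hcl j g' hg' =>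
      have h1 := Ga_comm i j hg hg'
      have h2 := Ga_comm j i hg' hg
      rw [lb_cl, lb_cl, add_eq_zero_iff_eq_neg, ← cl_inv]
      exact cl_congr (add_comm _ _) (commutatorElement_inv _ _).symm _ _

theorem lb_self (x : LR G) : lb x x = 0 := by
  induction x using LR_ind with
  | h0 => simp
  | hadd x y hx hy =>
    rw [map_add, map_add, AddMonoidHom.add_apply, AddMonoidHom.add_apply, hx, hy, zero_add,
      add_zero, lb_skew]
  | hcl i g hg =>
    rw [lb_cl, ← cl_one (i + i)]
    exact cl_congr rfl (by simp) _ _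

theorem lb_jacobi (x y z : LR G) : lb (lb x y) z + lb (lb y z) x + lb (lb z x) y = 0 := by
  induction x using LR_ind with
  | h0 => simp
  | hadd x x' hx hx' =>
    simp only [map_add, AddMonoidHom.add_apply]
    calc _ = (lb (lb x y) z + lb (lb y z) x + lb (lb z x) y) +
      (lb (lb x' y) z + lb (lb y z) x' + lb (lb z x') y) := by abel
      _ = 0 := by rw [hx, hx', add_zero]
  | hcl i a ha =>
    induction y using LR_ind with
    | h0 => simp
    | hadd x x' hx hx' =>
      generalize cl i a ha = y at *
      simp only [map_add, AddMonoidHom.add_apply]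
      calc _ = (lb (lb y x) z + lb (lb x z) y + lb (lb z y) x) +
        (lb (lb y x') z + lb (lb x' z) y + lb (lb z y) x') := by abel
        _ = 0 := by rw [hx, hx', add_zero]
    | hcl j b hb =>
      induction z using LR_ind with
      | h0 => simp
      | hadd x x' hx hx' =>
        generalize cl i a ha = y at *
        generalize cl j b hb = z at *
        simp only [map_add, AddMonoidHom.add_apply]
        calc _ = (lb (lb y z) x + lb (lb z x) y + lb (lb x y) z) +
          (lb (lb y z) x' + lb (lb z x') y + lb (lb x' y) z) := by abel
          _ = 0 := by rw [hx, hx', add_zero]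
      | hcl k c hc =>
        rw [← cl_conj k b hc, lb_cl i j ha hb, lb_cl]
        rw [cl_conj k b hc, lb_cl j k hb hc, ← cl_conj i c ha, lb_cl]
        rw [cl_conj i c ha, lb_cl k i hc ha, ← cl_conj j a hb, lb_cl]
        have e2 : j + k + i = i + j + k := by ring
        have e3 : k + i + j = i + j + k := by ring
        have m1 := Ga_comm (i + j) k (Ga_comm i j ha hb) ((Ga_normal G k).conj_mem _ hc b)
        have m2 := Ga_comm (j + k) i (Ga_comm j k hb hc) ((Ga_normal G i).conj_mem _ ha c)
        have m3 := Ga_comm (k + i) j (Ga_comm k i hc ha) ((Ga_normal G j).conj_mem _ hb a)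
        have m2' := m2
        have m3' := m3
        rw [e2] at m2'
        rw [e3] at m3'
        rw [cl_congr e2 rfl m2 m2', cl_congr e3 rfl m3 m3', ← cl_mul, ← cl_mul, ← cl_one (i + j + k)]
        exact cl_congr rfl (commutatorElement_commutatorElement_conj_mul a b c) _ _

instance : LieRing (LR G) where
  bracket x y := lb x y
  add_lie x y z := by change lb (x + y) z = lb x z + lb y z; simp
  lie_add x y z := by change lb x (y + z) = lb x y + lb x z; simp
  lie_self := lb_self
  leibniz_lie x y z := by
    change lb x (lb y z) = lb (lb x y) z + lb y (lb x z)
    have h1 := lb_jacobi x y z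
    have h2 := lb_skew x (lb y z)
    have h3 := lb_skew y (lb x z)
    have h4 := lb_skew x z
    rw [add_eq_zero_iff_eq_neg.1 h2, add_eq_zero_iff_eq_neg.1 h3, add_eq_zero_iff_eq_neg.1 h4,
      map_neg, AddMonoidHom.neg_apply, neg_neg]
    rw [neg_eq_iff_add_eq_zero, ← h1]
    abel

theorem lie_cl (i j : ℕ) {x y : G} (hx : x ∈ Ga G i) (hy : y ∈ Ga G j) :
    ⁅cl i x hx, cl j y hy⁆ = cl (i + j) ⁅x, y⁆ (Ga_comm i j hx hy) := lb_cl i j hx hy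

theorem cl_mem_lcs (r : ℕ) (x : G) (hx : x ∈ Ga G (r + 1)) : cl (r + 1) x hx ∈ lcs ℤ (LR G) r := by
  induction r generalizing x with
  | zero => trivial
  | succ r ih =>
    have key : Ga G (r + 1 + 1) = Subgroup.closure
        {g | ∃ g₁ ∈ Ga G (r + 1), ∃ g₂ ∈ (⊤ : Subgroup G), ⁅g₁, g₂⁆ = g} := rfl
    have hx' := hx
    rw [key] at hx'
    induction hx' using Subgroup.closure_induction with
    | mem y hy =>
      obtain ⟨a, ha, b, -, rfl⟩ := hy
      have := mem_mb (ih a ha) (Submodule.mem_top (R := ℤ) (x := cl 1 b (by simp [Ga])))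
      rw [lie_cl] at this
      exact this
    | one => rw [cl_one]; exact zero_mem _
    | mul y z hy hz h1 h2 =>
      rw [← key] at hy hz
      rw [cl_mul _ hy hz]
      exact add_mem (h1 hy) (h2 hz)
    | inv y hy h1 =>
      rw [← key] at hy
      rw [cl_inv _ hy]
      exact neg_mem (h1 hy)

theorem Ga_map (φ : MulAut G) (n : ℕ) {g : G} (h : g ∈ Ga G n) : φ g ∈ Ga G n := by
  have : (Ga G n).Characteristic := by unfold Ga; infer_instance
  have := (Subgroup.characteristic_iff_le_comap.1 this) φ
  exact this h

/-- Induced map on the factors. -/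
def qmap (φ : MulAut G) (n : ℕ) : GQ G n →* GQ G n :=
  QuotientGroup.lift _
    { toFun := fun x => qc n (φ x) (Ga_map φ n x.2)
      map_one' := qc_eq_one _ _ (by simp)
      map_mul' := fun x y => by
        rw [← qc_mul]
        exact qc_congr _ (by simp) _ _ } (by
    intro x hx
    exact qc_eq_one _ _ (Ga_map φ (n + 1) hx))

/-- Induced map on the Lie ring. -/
def lmap (φ : MulAut G) : LR G →+ LR G :=
  DirectSum.map (α := GA G) (β := GA G) (fun n => (qmap φ n).toAdditive)

theorem lmap_cl (φ : MulAut G) (n : ℕ) {g : G} (h : g ∈ Ga G n) :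
    lmap φ (cl n g h) = cl n (φ g) (Ga_map φ n h) := by
  exact DirectSum.map_of _ _ _

theorem lmap_lie (φ : MulAut G) (x y : LR G) : lmap φ ⁅x, y⁆ = ⁅lmap φ x, lmap φ y⁆ := by
  induction x using LR_ind with
  | h0 => simp
  | hadd x x' hx hx' => simp only [add_lie, map_add, hx, hx']
  | hcl i g hg =>
    induction y using LR_ind with
    | h0 => simp
    | hadd x x' hx hx' => simp only [lie_add, map_add, hx, hx']
    | hcl j g' hg' =>
      rw [lie_cl, lmap_cl, lmap_cl, lmap_cl, lie_cl]
      exact cl_congr rfl (map_commutatorElement _ _ _) _ _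

theorem cl_pow (n : ℕ) {g : G} (h : g ∈ Ga G n) (k : ℕ) :
    cl n (g ^ k) (pow_mem h k) = k • cl n g h := by
  induction k with
  | zero => rw [zero_smul, ← cl_one n]; exact cl_congr rfl (pow_zero _) _ _
  | succ k ih =>
    rw [succ_nsmul, ← ih, ← cl_mul]
    exact cl_congr rfl (pow_succ _ _) _ _

theorem lmap_pow_cl (φ : MulAut G) (n : ℕ) {g : G} (h : g ∈ Ga G n) (k : ℕ) :
    ((lmap φ).toIntLinearMap ^ k) (cl n g h) = cl n ((φ ^ k) g) (Ga_map (φ ^ k) n h) := by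
  induction k with
  | zero => rfl
  | succ k ih =>
    rw [pow_succ', Module.End.mul_apply, ih]
    change lmap φ _ = _
    rw [lmap_cl]
    exact cl_congr rfl (by rw [pow_succ']; rfl) _ _

theorem cl_prod (n : ℕ) (f : ℕ → G) (hf : ∀ j, f j ∈ Ga G n) (k : ℕ)
    (h : ((List.range k).map f).prod ∈ Ga G n) :
    cl n ((List.range k).map f).prod h = ∑ j ∈ Finset.range k, cl n (f j) (hf j) := by
  induction k with
  | zero => exact cl_one n
  | succ k ih =>
    have h1 : ((List.range k).map f).prod ∈ Ga G n := by
      refine Subgroup.list_prod_mem _ fun x hx => ?_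
      obtain ⟨j, -, rfl⟩ := List.mem_map.1 hx
      exact hf j
    rw [Finset.sum_range_succ, ← ih h1, ← cl_mul]
    exact cl_congr rfl (by rw [List.range_succ, List.map_append, List.prod_append]; simp) _ _

/-- The lower central series of a group with a splitting automorphism stabilizes. -/
theorem Ga_stable {p : ℕ} (hp : p.Prime)
    (hp' : ∀ g : G, ¬ p ∣ orderOf g) (φ : MulAut G)
    (hsplit : ∀ g : G, ((List.range p).map fun i => (φ ^ i) g).prod = 1) :
    (⊤ : Subgroup G).lowerCentralSeries (p ^ KN p) ≤
      (⊤ : Subgroup G).lowerCentralSeries (p ^ KN p + 1) := by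
  have main : lcs ℤ (LR G) (p ^ KN p) = ⊥ := by
    refine higman_int hp (lmap φ).toIntLinearMap (lmap_lie φ) ?_ ?_
    · intro x
      induction x using LR_ind with
      | h0 => simp
      | hadd x x' hx hx' => simp only [map_add, Finset.sum_add_distrib, hx, hx', add_zero]
      | hcl n g h =>
        have e := cl_prod n (fun j => (φ ^ j) g) (fun j => Ga_map (φ ^ j) n h) p
          (by rw [hsplit]; exact one_mem _)
        rw [cl_congr rfl (hsplit g) _ (one_mem _), cl_one] at e
        rw [e]
        exact Finset.sum_congr rfl fun j _ => lmap_pow_cl φ n h j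
    · intro x
      induction x using LR_ind with
      | h0 => exact ⟨1, by simp, by simp⟩
      | hadd x x' hx hx' =>
        obtain ⟨m, h1, h2⟩ := hx
        obtain ⟨n, h3, h4⟩ := hx'
        refine ⟨m * n, Nat.Coprime.mul_left h1 h3, ?_⟩
        rw [smul_add, mul_smul m n x', h4, mul_comm, mul_smul n m x, h2, smul_zero, smul_zero,
          add_zero]
      | hcl n g h =>
        refine ⟨orderOf g, ((Nat.Prime.coprime_iff_not_dvd hp).2 (hp' g)).symm, ?_⟩
        rw [← cl_pow, ← cl_one n]
        exact cl_congr rfl (pow_orderOf_eq_one g) _ _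
  intro x hx
  have h1 := cl_mem_lcs (p ^ KN p) x hx
  rw [main, Submodule.mem_bot] at h1
  exact cl_eq_zero _ _ h1

end GroupLie
end Hig
namespace Hig

section FPF

variable {F : Type*} [Group F] [Finite F]

theorem fpf_surj (ψ : F →* F) (hfix : ∀ x, ψ x = x → x = 1) (y : F) : ∃ x, x⁻¹ * ψ x = y := by
  have hinj : Function.Injective fun x : F => x⁻¹ * ψ x := by
    intro x y h
    have h : x⁻¹ * ψ x = y⁻¹ * ψ y := h
    have : ψ (y * x⁻¹) = y * x⁻¹ := by
      rw [map_mul, map_inv, mul_inv_eq_iff_eq_mul, mul_assoc, h]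
      simp
    have := hfix _ this
    exact (mul_inv_eq_one.1 this).symm
  exact Finite.surjective_of_injective hinj y

/-- Restriction of an endomorphism to an invariant subgroup. -/
def rst (ψ : F →* F) (H : Subgroup F) (hH : ∀ x ∈ H, ψ x ∈ H) : H →* H :=
  (ψ.comp H.subtype).codRestrict H (fun x => hH x x.2)

theorem rst_coe (ψ : F →* F) (H : Subgroup F) (hH : ∀ x ∈ H, ψ x ∈ H) (x : H) :
    (rst ψ H hH x : F) = ψ x := rfl

theorem rst_fix (ψ : F →* F) (hfix : ∀ x, ψ x = x → x = 1) (H : Subgroup F)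
    (hH : ∀ x ∈ H, ψ x ∈ H) (x : H) (hx : rst ψ H hH x = x) : x = 1 := by
  have := hfix x (by rw [← rst_coe ψ H hH, hx])
  exact Subtype.ext this

theorem rst_inj (ψ : F →* F) (hinj : Function.Injective ψ) (H : Subgroup F)
    (hH : ∀ x ∈ H, ψ x ∈ H) : Function.Injective (rst ψ H hH) := by
  intro x y h
  exact Subtype.ext (hinj (congrArg Subtype.val h))

theorem rst_surj (ψ : F →* F) (hinj : Function.Injective ψ) (H : Subgroup F)
    (hH : ∀ x ∈ H, ψ x ∈ H) (h : F) (hh : h ∈ H) : ∃ h' ∈ H, ψ h' = h := by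
  obtain ⟨z, hz⟩ := Finite.surjective_of_injective (rst_inj ψ hinj H hH) ⟨h, hh⟩
  exact ⟨z, z.2, congrArg Subtype.val hz⟩

theorem mem_conj_sylow {q : ℕ} (g : F) (Q : Sylow q F) (x : F) :
    x ∈ g • Q ↔ g⁻¹ * x * g ∈ Q := by
  rw [← SetLike.mem_coe, Sylow.coe_smul, Set.mem_smul_set_iff_inv_smul_mem]
  simp [MulAut.smul_def]

theorem inv_sylow (ψ : F →* F) (hinj : Function.Injective ψ) (hfix : ∀ x, ψ x = x → x = 1)
    (q : ℕ) [Fact q.Prime] : ∃ Q : Sylow q F, ∀ x ∈ Q, ψ x ∈ Q := by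
  let Q0 : Sylow q F := default
  let Q1 : Sylow q F := Sylow.ofCard ((Q0 : Subgroup F).map ψ) (by
    rw [Subgroup.card_map_of_injective hinj]
    exact Q0.card_eq_multiplicity)
  obtain ⟨g, hg⟩ := MulAction.exists_smul_eq F Q0 Q1
  obtain ⟨y, hy⟩ := fpf_surj ψ hfix g⁻¹
  refine ⟨y • Q0, fun x hx => ?_⟩
  rw [mem_conj_sylow] at hx ⊢
  have h1 : ψ (y⁻¹ * x * y) ∈ Q1 := Subgroup.mem_map_of_mem ψ hx
  rw [← hg, mem_conj_sylow] at h1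
  have hy' : ψ y = y * g⁻¹ := by rw [← hy]; simp
  convert h1 using 1
  rw [map_mul, map_mul, map_inv, hy']
  group

theorem mem_norm_of {Q : Subgroup F} {x : F} (h : ∀ y ∈ Q, x * y * x⁻¹ ∈ Q) :
    x ∈ Subgroup.normalizer (Q : Set F) := by
  refine Subgroup.mem_normalizer_fintype h

theorem norm_inv (ψ : F →* F) (hinj : Function.Injective ψ) (Q : Subgroup F)
    (hQ : ∀ x ∈ Q, ψ x ∈ Q) : ∀ x ∈ Subgroup.normalizer (Q : Set F),
      ψ x ∈ Subgroup.normalizer (Q : Set F) := by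
  intro n hn
  apply mem_norm_of
  intro h hh
  obtain ⟨h', hh', rfl⟩ := rst_surj ψ hinj Q hQ h hh
  rw [← map_inv, ← map_mul, ← map_mul]
  exact hQ _ ((Subgroup.mem_normalizer_iff.1 hn h').1 hh')

theorem inv_sylow_unique (ψ : F →* F) (hinj : Function.Injective ψ) (hfix : ∀ x, ψ x = x → x = 1)
    (q : ℕ) [Fact q.Prime] (Q Q' : Sylow q F) (hQ : ∀ x ∈ Q, ψ x ∈ Q)
    (hQ' : ∀ x ∈ Q', ψ x ∈ Q') {z : F} (hz : z ∈ Q') : z ∈ Q := by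
  obtain ⟨x, rfl⟩ := MulAction.exists_smul_eq F Q Q'
  have hN := norm_inv ψ hinj Q hQ
  have hx : x⁻¹ * ψ x ∈ Subgroup.normalizer ((Q : Subgroup F) : Set F) := by
    apply mem_norm_of
    intro h hh
    obtain ⟨h', hh', rfl⟩ := rst_surj ψ hinj Q hQ h hh
    have h1 : x * h' * x⁻¹ ∈ x • Q := by
      rw [mem_conj_sylow]
      have hh2 : h' ∈ Q := hh'
      simpa [mul_assoc] using hh2
    have h2 := hQ' _ h1
    rw [mem_conj_sylow] at h2
    change x⁻¹ * ψ x * ψ h' * (x⁻¹ * ψ x)⁻¹ ∈ Q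
    simpa [mul_assoc] using h2
  obtain ⟨m, hm⟩ := fpf_surj (rst ψ _ hN) (rst_fix ψ hfix _ hN) ⟨_, hx⟩
  have hm : (m : F)⁻¹ * ψ m = x⁻¹ * ψ x := congrArg Subtype.val hm
  have hf : ψ (x * (m : F)⁻¹) = x * (m : F)⁻¹ := by
    rw [map_mul, map_inv, mul_inv_eq_iff_eq_mul, mul_assoc, hm]
    simp
  have hxm := mul_inv_eq_one.1 (hfix _ hf)
  rw [mem_conj_sylow] at hz
  have hxN : x ∈ Subgroup.normalizer ((Q : Subgroup F) : Set F) := hxm ▸ m.2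
  have : x * (x⁻¹ * z * x) * x⁻¹ ∈ Q := (Subgroup.mem_normalizer_iff.1 hxN _).1 hz
  simpa [mul_assoc] using this

theorem inv_le_sylow (ψ : F →* F) (hinj : Function.Injective ψ) (hfix : ∀ x, ψ x = x → x = 1)
    (q : ℕ) [Fact q.Prime] (R : Subgroup F) (hR : IsPGroup q R) (hRi : ∀ x ∈ R, ψ x ∈ R) :
    ∃ Q : Sylow q F, (∀ x ∈ Q, ψ x ∈ Q) ∧ R ≤ Q := by
  obtain ⟨M, hRM, ⟨hM1, hM2⟩, hM3⟩ := Set.Finite.exists_le_maximal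
    (s := {H : Subgroup F | IsPGroup q H ∧ ∀ x ∈ H, ψ x ∈ H}) (Set.toFinite _) ⟨hR, hRi⟩
  have hN := norm_inv ψ hinj M hM2
  obtain ⟨S, hS⟩ := inv_sylow (rst ψ _ hN) (rst_inj ψ hinj _ hN) (rst_fix ψ hfix _ hN) q
  let N := Subgroup.normalizer (M : Set F)
  have hMN : M ≤ N := Subgroup.le_normalizer
  have hnorm : (M.subgroupOf N).Normal := Subgroup.normal_in_normalizer
  have hle : M.subgroupOf N ≤ S := by
    have hp : IsPGroup q (M.subgroupOf N) := hM1.comap_subtype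
    obtain ⟨P, hP⟩ := hp.exists_le_sylow
    obtain ⟨g, hg⟩ := MulAction.exists_smul_eq N P S
    intro z hz
    rw [← hg]
    change z ∈ g • P
    rw [mem_conj_sylow]
    apply hP
    have := hnorm.conj_mem z hz g⁻¹
    rwa [inv_inv] at this
  have hT1 : IsPGroup q ((S : Subgroup N).map N.subtype) := S.isPGroup'.map _
  have hT2 : ∀ x ∈ (S : Subgroup N).map N.subtype, ψ x ∈ (S : Subgroup N).map N.subtype := by
    rintro _ ⟨s, hs, rfl⟩
    exact ⟨_, hS s hs, rfl⟩
  have hT3 : M ≤ (S : Subgroup N).map N.subtype := fun z hz => ⟨⟨z, hMN hz⟩, hle hz, rfl⟩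
  have hT4 := hM3 ⟨hT1, hT2⟩ hT3
  have hSM : (S : Subgroup N) = M.subgroupOf N := by
    refine le_antisymm (fun z hz => ?_) hle
    exact hT4 ⟨z, hz, rfl⟩
  obtain ⟨n, hn⟩ := IsPGroup.iff_card.1 hM1
  have hnd : ¬ q ^ (n + 1) ∣ Nat.card F := by
    intro hd
    have h1 := Sylow.prime_dvd_card_quotient_normalizer hd hn
    have h2 := S.not_dvd_index
    rw [hSM] at h2
    exact h2 h1
  have hcard : Nat.card M = q ^ (Nat.card F).factorization q := by
    rw [hn]
    congr 1
    have hq : q.Prime := Fact.out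
    have h0 : Nat.card F ≠ 0 := Nat.card_pos.ne'
    apply le_antisymm
    · rw [← hq.pow_dvd_iff_le_factorization h0, ← hn]
      exact Subgroup.card_subgroup_dvd_card M
    · by_contra hc
      exact hnd ((hq.pow_dvd_iff_le_factorization h0).2 (by omega))
  exact ⟨Sylow.ofCard M hcard, hM2, hRM⟩

theorem mem_sylow_of_normal {q : ℕ} [Fact q.Prime] (P : Sylow q F) (hP : (P : Subgroup F).Normal)
    {x : F} {k : ℕ} (hx : x ^ q ^ k = 1) : x ∈ P := by
  have hz : IsPGroup q (Subgroup.zpowers x) := by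
    have h1 : orderOf x ∣ q ^ k := orderOf_dvd_of_pow_eq_one hx
    obtain ⟨j, -, hj⟩ := (Nat.dvd_prime_pow Fact.out).1 h1
    exact IsPGroup.of_card (n := j) (by rw [Nat.card_zpowers, hj])
  obtain ⟨S, hS⟩ := hz.exists_le_sylow
  obtain ⟨g, hg⟩ := MulAction.exists_smul_eq F P S
  have h1 : x ∈ S := hS (Subgroup.mem_zpowers x)
  rw [← hg, mem_conj_sylow] at h1
  have : g * (g⁻¹ * x * g) * g⁻¹ ∈ P := hP.conj_mem _ h1 g
  simpa [mul_assoc] using this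

theorem fpf_nilpotent (ψ : F →* F) (hinj : Function.Injective ψ) (hfix : ∀ x, ψ x = x → x = 1)
    (hK : ∀ g : F, ∃ K : Subgroup F, g ∈ K ∧ (∀ x ∈ K, ψ x ∈ K) ∧ Group.IsNilpotent K) :
    Group.IsNilpotent F := by
  refine (Group.isNilpotent_of_finite_tfae (G := F).out 0 3).2 ?_
  intro q hq P
  obtain ⟨Q, hQ⟩ := inv_sylow ψ hinj hfix q
  have key : ∀ (x : F) (k : ℕ), x ^ q ^ k = 1 → x ∈ Q := by
    intro x k hx
    obtain ⟨K, hxK, hKi, hKn⟩ := hK x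
    let S : Sylow q K := default
    have hSn : (S : Subgroup K).Normal := inferInstance
    obtain ⟨Q', hQ'1, hQ'2⟩ := inv_le_sylow ψ hinj hfix q ((S : Subgroup K).map K.subtype)
      (S.isPGroup'.map _) (by
        rintro _ ⟨s, hs, rfl⟩
        refine ⟨rst ψ K hKi s, ?_, rfl⟩
        obtain ⟨j, hj⟩ := S.isPGroup' ⟨s, hs⟩
        have hj : s ^ q ^ j = 1 := congrArg Subtype.val hj
        refine mem_sylow_of_normal S hSn (k := j) ?_
        rw [← map_pow, hj, map_one])
    refine inv_sylow_unique ψ hinj hfix q Q Q' hQ hQ'1 (hQ'2 ?_)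
    exact ⟨⟨x, hxK⟩, mem_sylow_of_normal S hSn (k := k) (Subtype.ext hx), rfl⟩
  have hPel : ∀ x ∈ P, ∃ k : ℕ, x ^ q ^ k = 1 := by
    intro x hx
    obtain ⟨j, hj⟩ := P.isPGroup' ⟨x, hx⟩
    exact ⟨j, congrArg Subtype.val hj⟩
  have hPQ : (P : Subgroup F) ≤ Q := fun x hx => by
    obtain ⟨k, hk⟩ := hPel x hx
    exact key x k hk
  have hQP : (Q : Subgroup F) = P := P.is_maximal' Q.isPGroup' hPQ
  refine ⟨fun x hx g => ?_⟩
  rw [← hQP]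
  obtain ⟨k, hk⟩ := hPel x hx
  exact key _ k (by rw [conj_pow, hk]; simp)

end FPF

/-- The main argument. -/
theorem main_thm (p : ℕ) (hp : p.Prime) (G : Type*) [Group G]
    (hper : ∀ g : G, IsOfFinOrder g)
    (hp' : ∀ g : G, ¬ p ∣ orderOf g)
    (hRF : ∀ x : G, x ≠ 1 → ∃ N : Subgroup G, N.Normal ∧ N.FiniteIndex ∧ x ∉ N)
    (φ : MulAut G) (hord : orderOf φ = p)
    (hsplit : ∀ g : G, ((List.range p).map fun i => (φ ^ i) g).prod = 1)
    (hnilp : ∀ g : G,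
      Group.IsNilpotent (Subgroup.closure ((fun i : ℕ => (φ ^ i) g) '' Set.Iio p))) :
    Group.IsNilpotent G := by
  have hst := Ga_stable hp hp' φ hsplit
  set c := p ^ KN p with hc
  have hst' : ∀ n, (⊤ : Subgroup G).lowerCentralSeries c ≤
      (⊤ : Subgroup G).lowerCentralSeries (c + n) := by
    intro n
    induction n with
    | zero => exact le_rfl
    | succ n ih =>
      refine hst.trans ?_
      rw [← add_assoc, Subgroup.lowerCentralSeries_succ, Subgroup.lowerCentralSeries_succ]
      exact Subgroup.commutator_mono ih le_rfl
  have hφp : φ ^ p = 1 := by rw [← hord]; exact pow_orderOf_eq_one φ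
  have hφs : ∀ (i : ℕ) (x : G), (φ ^ i) (φ x) = (φ ^ (i + 1)) x := fun i x => by
    rw [pow_succ]; rfl
  have hφs' : ∀ (i : ℕ) (x : G), φ ((φ ^ i) x) = (φ ^ (i + 1)) x := fun i x => by
    rw [pow_succ']; rfl
  rw [Subgroup.nilpotent_iff_lowerCentralSeries]
  refine ⟨c, ?_⟩
  rw [eq_bot_iff]
  intro x hx
  rw [Subgroup.mem_bot]
  by_contra hx1
  obtain ⟨N, hN, hNf, hxN⟩ := hRF x hx1
  let M : Subgroup G := ⨅ i : Fin p, N.comap (φ ^ (i : ℕ)).toMonoidHom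
  have hMmem : ∀ y, y ∈ M ↔ ∀ i : ℕ, (φ ^ i) y ∈ N := by
    intro y
    constructor
    · intro h i
      have h1 := Subgroup.mem_iInf.1 h ⟨i % p, Nat.mod_lt _ hp.pos⟩
      have h2 : (φ ^ (i % p)) y ∈ N := h1
      rw [← hord, pow_mod_orderOf] at h2
      exact h2
    · intro h
      exact Subgroup.mem_iInf.2 fun i => h i
  have hMn : M.Normal := ⟨fun y hy g => by
    rw [hMmem] at hy ⊢
    intro i
    rw [map_mul, map_mul, map_inv]
    exact hN.conj_mem _ (hy i) _⟩
  have hMf : M.FiniteIndex := by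
    have : ∀ i : Fin p, (N.comap (φ ^ (i : ℕ)).toMonoidHom).FiniteIndex := fun i => ⟨by
      rw [Subgroup.index_comap_of_surjective N (f := (φ ^ (i : ℕ)).toMonoidHom)
        (φ ^ (i : ℕ)).surjective]
      exact hNf.index_ne_zero⟩
    exact Subgroup.finiteIndex_iInf this
  have hxM : x ∉ M := fun h => hxN ((hMmem x).1 h 0)
  have hMφ : M ≤ M.comap φ.toMonoidHom := by
    intro y hy
    rw [hMmem] at hy
    change φ y ∈ M
    rw [hMmem]
    intro i
    rw [hφs]
    exact hy _
  have hMφ' : ∀ y, φ y ∈ M → y ∈ M := by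
    intro y hy
    rw [hMmem] at hy ⊢
    intro i
    have h1 := hy (i + (p - 1))
    rw [hφs, show i + (p - 1) + 1 = i + p by have := hp.pos; omega, pow_add, hφp, mul_one] at h1
    exact h1
  have hfin : Finite (G ⧸ M) := inferInstance
  let ψ : G ⧸ M →* G ⧸ M := QuotientGroup.map M M φ.toMonoidHom hMφ
  have hψ : ∀ y : G, ψ (y : G ⧸ M) = ((φ y : G) : G ⧸ M) := fun y => rfl
  have hinj : Function.Injective ψ := by
    rw [injective_iff_map_eq_one]
    intro a
    induction a using QuotientGroup.induction_on with
    | H z =>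
      intro h
      rw [hψ, QuotientGroup.eq_one_iff] at h
      exact (QuotientGroup.eq_one_iff z).2 (hMφ' z h)
  have hfix : ∀ a, ψ a = a → a = 1 := by
    intro a
    induction a using QuotientGroup.induction_on with
    | H z =>
      intro h
      rw [hψ] at h
      have h1 : ∀ i : ℕ, (((φ ^ i) z : G) : G ⧸ M) = (z : G ⧸ M) := by
        intro i
        induction i with
        | zero => rfl
        | succ i ih => rw [← hφs', ← hψ, ih, hψ, h]
      have h2 := congrArg (QuotientGroup.mk' M) (hsplit z)
      rw [map_list_prod, List.map_map, map_one] at h2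
      have h3 : (List.range p).map ((QuotientGroup.mk' M) ∘ fun i => (φ ^ i) z) =
          (List.range p).map fun _ => (z : G ⧸ M) := List.map_congr_left fun i _ => h1 i
      rw [h3, List.map_const', List.prod_replicate, List.length_range] at h2
      have h4 : orderOf (z : G ⧸ M) ∣ p := orderOf_dvd_of_pow_eq_one h2
      have h5 : orderOf (z : G ⧸ M) ∣ orderOf z := orderOf_map_dvd (QuotientGroup.mk' M) z
      rcases (Nat.dvd_prime hp).1 h4 with h6 | h6
      · exact orderOf_eq_one_iff.1 h6
      · exact absurd (h6 ▸ h5) (hp' z)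
  have hF : Group.IsNilpotent (G ⧸ M) := by
    refine fpf_nilpotent ψ hinj hfix ?_
    intro a
    induction a using QuotientGroup.induction_on with
    | H z =>
      let C := Subgroup.closure ((fun i : ℕ => (φ ^ i) z) '' Set.Iio p)
      have hC : C ≤ C.comap φ.toMonoidHom := by
        rw [Subgroup.closure_le]
        rintro _ ⟨i, hi, rfl⟩
        change φ ((φ ^ i) z) ∈ C
        rw [hφs']
        by_cases h : i + 1 = p
        · rw [h, hφp]
          exact Subgroup.subset_closure ⟨0, hp.pos, rfl⟩
        · exact Subgroup.subset_closure ⟨i + 1, by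
            have : i < p := hi
            exact lt_of_le_of_ne this h, rfl⟩
      refine ⟨C.map (QuotientGroup.mk' M), ?_, ?_, ?_⟩
      · exact ⟨z, Subgroup.subset_closure ⟨0, hp.pos, rfl⟩, rfl⟩
      · rintro _ ⟨w, hw, rfl⟩
        exact ⟨φ w, hC hw, rfl⟩
      · have := hnilp z
        exact Group.nilpotent_of_surjective ((QuotientGroup.mk' M).subgroupMap C)
          ((QuotientGroup.mk' M).subgroupMap_surjective C)
  obtain ⟨n, hn⟩ := Subgroup.nilpotent_iff_lowerCentralSeries.1 hF
  have h1 := hst' n hx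
  have h2 := Subgroup.lowerCentralSeries_antitone (⊤ : Subgroup G) (Nat.le_add_left n c) h1
  have h3 := Subgroup.mem_map_of_mem (QuotientGroup.mk' M) h2
  rw [Subgroup.map_lowerCentralSeries, Subgroup.map_top_of_surjective _
    (QuotientGroup.mk'_surjective M), hn, Subgroup.mem_bot] at h3
  exact hxM ((QuotientGroup.eq_one_iff x).1 h3)

end Hig

/-- A periodic residually finite `p'`-group admitting a splitting automorphism `φ` of prime
order `p` such that `⟨g, φ g, …, φ^(p-1) g⟩` is nilpotent for every `g` is nilpotent. -/
theorem stmt_1 (p : ℕ) (hp : p.Prime) (G : Type*) [Group G]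
    (hper : ∀ g : G, IsOfFinOrder g)
    (hp' : ∀ g : G, ¬ p ∣ orderOf g)
    (hRF : ∀ x : G, x ≠ 1 → ∃ N : Subgroup G, N.Normal ∧ N.FiniteIndex ∧ x ∉ N)
    (φ : MulAut G) (hord : orderOf φ = p)
    (hsplit : ∀ g : G, ((List.range p).map fun i => (φ ^ i) g).prod = 1)
    (hnilp : ∀ g : G,
      Group.IsNilpotent (Subgroup.closure ((fun i : ℕ => (φ ^ i) g) '' Set.Iio p))) :
    Group.IsNilpotent G := by
  exact Hig.main_thm p hp G hper hp' hRF φ hord hsplit hnilp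
end

section
/- Let p be a prime and let G be a p'-group admitting a splitting automorphism φ of order p such that for every g ∈ G the subgroup ⟨g, φ(g), φ²(g), …, φ^{p-1}(g)⟩ is nilpotent. Then G is not a Tarski monster; that is, there is no prime q such that G is infinite and every proper nontrivial subgroup of G is cyclic of order q. -/
theorem aux_no_normal (G : Type*) [Group G] [Infinite G] (q : ℕ)
    (hper : ∀ g : G, IsOfFinOrder g)
    (hT : ∀ H : Subgroup G, H ≠ ⊥ → H ≠ ⊤ → IsCyclic H ∧ Nat.card H = q)
    (y : G) (hy : y ≠ 1) (hn : (Subgroup.zpowers y).Normal) : False := by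
  have hfin : ∀ g : G, (Subgroup.zpowers g : Set G).Finite := fun g =>
    finite_zpowers.2 (hper g)
  have hne : ∀ H : Subgroup G, (H : Set G).Finite → H ≠ ⊤ := by
    rintro H hH rfl
    exact Set.infinite_univ (by simpa using hH)
  have hN := hne _ (hfin y)
  obtain ⟨x, -, hx⟩ := SetLike.exists_of_lt (lt_top_iff_ne_top.2 hN)
  have hfs : ((Subgroup.zpowers x ⊔ Subgroup.zpowers y : Subgroup G) : Set G).Finite := by
    rw [Subgroup.mul_normal]
    exact (hfin x).mul (hfin y)
  have hbot : Subgroup.zpowers y ≠ ⊥ := by simpa using hy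
  have hle : Subgroup.zpowers y ≤ Subgroup.zpowers x ⊔ Subgroup.zpowers y := le_sup_right
  have h1 := (hT _ hbot hN).2
  have h2 := (hT _ (fun h => hbot (le_bot_iff.1 (h ▸ hle))) (hne _ hfs)).2
  have : Finite (Subgroup.zpowers x ⊔ Subgroup.zpowers y : Subgroup G) := hfs
  have h3 := Subgroup.eq_of_le_of_card_ge hle (by omega)
  apply hx
  rw [h3]
  exact (le_sup_left : Subgroup.zpowers x ≤ _) (Subgroup.mem_zpowers x)

/-- A `p'`-group admitting a splitting automorphism `φ` of prime order `p` such that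
`⟨g, φ g, …, φ^(p-1) g⟩` is nilpotent for every `g` is not a Tarski monster. -/
theorem stmt_2 (p : ℕ) (hp : p.Prime) (G : Type*) [Group G]
    (hper : ∀ g : G, IsOfFinOrder g)
    (hp' : ∀ g : G, ¬ p ∣ orderOf g)
    (φ : MulAut G) (hord : orderOf φ = p)
    (hsplit : ∀ g : G, ((List.range p).map fun i => (φ ^ i) g).prod = 1)
    (hnilp : ∀ g : G,
      Group.IsNilpotent (Subgroup.closure ((fun i : ℕ => (φ ^ i) g) '' Set.Iio p))) :
    ¬ ∃ q : ℕ, q.Prime ∧ Infinite G ∧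
        ∀ H : Subgroup G, H ≠ ⊥ → H ≠ ⊤ → IsCyclic H ∧ Nat.card H = q := by
  rintro ⟨q, hq, hinf, hT⟩
  have key := aux_no_normal G q hper hT
  have hfin : ∀ g : G, (Subgroup.zpowers g : Set G).Finite := fun g =>
    finite_zpowers.2 (hper g)
  have hcard : ∀ y : G, y ≠ 1 → Nat.card (Subgroup.zpowers y) = q := by
    intro y hy
    refine (hT _ (by simpa using hy) ?_).2
    intro h
    have := hfin y
    rw [h] at this
    exact Set.infinite_univ (by simpa using this)
  have heq : ∀ y : G, y ≠ 1 → ∀ H : Subgroup G, Nat.card H = q → y ∈ H →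
      Subgroup.zpowers y = H := by
    intro y hy H hH hm
    have : Finite H := Nat.finite_of_card_ne_zero (by rw [hH]; exact hq.ne_zero)
    exact Subgroup.eq_of_le_of_card_ge (by simpa using hm) (by rw [hH, hcard y hy])
  have hnn : ¬ Group.IsNilpotent G := by
    intro h
    have : Nontrivial (Subgroup.center G) :=
      (Subgroup.nontrivial_iff_ne_bot _).2 (Group.IsNilpotent.center_ne_bot G)
    obtain ⟨⟨z, hz⟩, hz1⟩ := exists_ne (1 : Subgroup.center G)
    refine key z (fun h => hz1 (Subtype.ext h)) ⟨?_⟩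
    intro n hn g
    have : n ∈ Subgroup.center G := (Subgroup.zpowers_le.2 hz) hn
    rw [Subgroup.mem_center_iff.1 this g]
    simpa using hn
  have hφ : ∀ y : G, y ≠ 1 → φ y ∈ Subgroup.zpowers y := by
    intro y hy
    set H := Subgroup.closure ((fun i : ℕ => (φ ^ i) y) '' Set.Iio p) with hH
    have h0 : y ∈ H := Subgroup.subset_closure ⟨0, hp.pos, by simp⟩
    have h1 : φ y ∈ H := Subgroup.subset_closure ⟨1, hp.one_lt, by simp⟩
    have hb : H ≠ ⊥ := by
      intro h
      rw [h] at h0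
      exact hy (by simpa using h0)
    have ht : H ≠ ⊤ := by
      intro h
      have hn := hnilp y
      rw [← hH, h] at hn
      exact hnn ((Group.isNilpotent_congr Subgroup.topEquiv).1 hn)
    rw [heq y hy H (hT H hb ht).2 h0]
    exact h1
  have hφ' : ∀ y : G, y ≠ 1 → Subgroup.zpowers (φ y) = Subgroup.zpowers y := fun y hy =>
    heq _ (by simpa using hy) _ (hcard y hy) (hφ y hy)
  have hfix : ∀ x : G, φ x = x → x = 1 := by
    intro x hx
    have h1 : ∀ i : ℕ, (φ ^ i) x = x := by
      intro i
      induction i with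
      | zero => simp
      | succ n ih => rw [pow_succ, MulAut.mul_apply, hx, ih]
    have h2 := hsplit x
    simp only [h1, List.map_const', List.length_range, List.prod_replicate] at h2
    rcases (Nat.dvd_prime hp).1 (orderOf_dvd_of_pow_eq_one h2) with h | h
    · exact orderOf_eq_one_iff.1 h
    · exact absurd (dvd_of_eq h.symm) (hp' x)
  obtain ⟨y, hy⟩ := exists_ne (1 : G)
  have hmap : ∀ g h : G, (Subgroup.zpowers h).map (MulAut.conj g).toMonoidHom
      = Subgroup.zpowers (g * h * g⁻¹) := by
    intro g h
    rw [MonoidHom.map_zpowers]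
    simp
  refine key y hy (Subgroup.normalizer_eq_top_iff.1 (top_le_iff.1 fun x _ => ?_))
  by_cases hx : x = 1
  · rw [hx]; exact one_mem _
  have hw : x⁻¹ * φ x ≠ 1 := fun h => hx (hfix x (inv_mul_eq_one.1 h).symm)
  have hwx : x⁻¹ * φ x ∈ Subgroup.zpowers x :=
    mul_mem (inv_mem (Subgroup.mem_zpowers x)) (hφ x hx)
  have hz := heq _ hw _ (hcard x hx) hwx
  suffices h : x⁻¹ * φ x ∈ Subgroup.normalizer (Subgroup.zpowers y : Set G) by
    refine (Subgroup.zpowers_le.2 h) ?_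
    rw [hz]
    exact Subgroup.mem_zpowers x
  have hc : x * y * x⁻¹ ≠ 1 := by
    intro h
    exact hy (conj_eq_one_iff.1 h)
  have e : (Subgroup.zpowers y).map (MulAut.conj (φ x)).toMonoidHom
      = (Subgroup.zpowers y).map (MulAut.conj x).toMonoidHom := by
    rw [hmap x, ← hφ' _ hc, ← hφ' y hy, hmap]
    simp
  rw [Subgroup.mem_normalizer_iff]
  intro h
  have h1 : h ∈ Subgroup.zpowers y ↔
      φ x * h * (φ x)⁻¹ ∈ (Subgroup.zpowers y).map (MulAut.conj (φ x)).toMonoidHom := by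
    constructor
    · intro hh
      exact ⟨h, hh, by simp⟩
    · rintro ⟨k, hk, hk'⟩
      have : k = h := by simpa using hk'
      exact this ▸ hk
  rw [h1, e]
  constructor
  · rintro ⟨k, hk, hk'⟩
    have hk2 : x * k * x⁻¹ = φ x * h * (φ x)⁻¹ := by simpa using hk'
    have : x⁻¹ * φ x * h * (x⁻¹ * φ x)⁻¹ = k := by
      calc _ = x⁻¹ * (φ x * h * (φ x)⁻¹) * x := by group
        _ = k := by rw [← hk2]; group
    rw [this]; exact hk
  · intro hh
    refine ⟨_, hh, ?_⟩
    simp [mul_assoc]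
end

section
/- Let G be a finite group and let φ be a fixed-point-free automorphism of G of order n. Then φ is a splitting automorphism of order n, i.e. for every g ∈ G one has g · φ(g) · φ²(g) ⋯ φ^{n-1}(g) = 1. -/
/-- A fixed-point-free automorphism of order `n` of a finite group is a splitting
automorphism of order `n`. -/
theorem stmt_4 (G : Type*) [Group G] [Finite G] (n : ℕ) (φ : MulAut G)
    (hord : orderOf φ = n)
    (hfpf : ∀ g : G, φ g = g → g = 1) :
    ∀ g : G, ((List.range n).map fun i => (φ ^ i) g).prod = 1 := by
  intro g
  have hpow : ∀ (i : ℕ) (x : G), (φ ^ i) x = φ^[i] x := by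
    intro i
    induction i with
    | zero => intro x; rfl
    | succ k ih => intro x; rw [pow_succ, MulAut.mul_apply, ih, Function.iterate_succ_apply]
  have hid : φ^[n] = _root_.id := by
    funext x
    rw [← hpow, ← hord, pow_orderOf_eq_one]
    rfl
  have hF : MonoidHom.FixedPointFree φ := hfpf
  simp only [hpow]
  exact hF.prod_pow_eq_one hid g
end

section
/- Let G be a periodic group admitting a fixed-point-free automorphism of order 2. Then G is abelian and contains no element of order 2. -/
/-- A periodic group admitting a fixed-point-free automorphism of order `2` is abelian
and contains no element of order `2`. -/
theorem stmt_6 (G : Type*) [Group G]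
    (hper : ∀ g : G, IsOfFinOrder g)
    (φ : MulAut G) (hord : orderOf φ = 2)
    (hfpf : ∀ g : G, φ g = g → g = 1) :
    (∀ a b : G, a * b = b * a) ∧ ∀ g : G, orderOf g ≠ 2 := by
  have hφ : ∀ g, φ (φ g) = g := by
    intro g
    have h : φ ^ 2 = 1 := hord ▸ pow_orderOf_eq_one φ
    have h2 := DFunLike.congr_fun h g
    simpa [pow_two] using h2
  have key : ∀ g, φ g = g⁻¹ := by
    intro g
    obtain ⟨c, hc⟩ : ∃ c, c = g⁻¹ * φ g := ⟨_, rfl⟩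
    have hci : φ c = c⁻¹ := by simp [hc, hφ]
    have hpos : 0 < orderOf c := (hper c).orderOf_pos
    have h1 := pow_orderOf_eq_one c
    rcases Nat.even_or_odd' (orderOf c) with ⟨k, hk | hk⟩
    · exfalso
      rw [hk, two_mul, pow_add] at h1
      have h2 : c ^ k = 1 := by
        apply hfpf
        rw [map_pow, hci, inv_pow]
        exact inv_eq_of_mul_eq_one_left h1
      have := orderOf_le_of_pow_eq_one (by omega) h2
      omega
    · have hd : c ^ (k + 1) * c ^ (k + 1) = c := by
        rw [← pow_add, show k + 1 + (k + 1) = (2 * k + 1) + 1 by ring, ← hk, pow_succ, h1, one_mul]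
      have hdi : φ (c ^ (k + 1)) = (c ^ (k + 1))⁻¹ := by rw [map_pow, hci, inv_pow]
      have hg : φ g = g * c := by simp [hc]
      generalize c ^ (k + 1) = d at hd hdi
      have h3 : g * d = 1 := by
        apply hfpf
        rw [map_mul, hg, hdi, ← hd]
        group
      rw [eq_inv_of_mul_eq_one_left h3, map_inv, hdi]
  refine ⟨fun a b => ?_, fun g hg => ?_⟩
  · have h := map_mul φ a⁻¹ b⁻¹
    simp only [key, mul_inv_rev, inv_inv] at h
    exact h.symm
  · have h1 : g ^ 2 = 1 := hg ▸ pow_orderOf_eq_one g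
    have h2 : g = 1 := by
      apply hfpf
      rw [key]
      exact inv_eq_of_mul_eq_one_left (by rw [← pow_two, h1])
    rw [h2, orderOf_one] at hg
    omega
end

section
/- Let p be a prime and let G be an infinite group in which every proper nontrivial subgroup is cyclic of order p. Then the center of G is trivial. -/
/-- An infinite group in which every proper nontrivial subgroup is cyclic of prime order `p`
has trivial center. -/
theorem stmt_14 (p : ℕ) (hp : p.Prime) (G : Type*) [Group G] [Infinite G]
    (htarski : ∀ H : Subgroup G, H ≠ ⊥ → H ≠ ⊤ → IsCyclic H ∧ Nat.card H = p) :
    Subgroup.center G = ⊥ := by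
  have hfin : ∀ g : G, IsOfFinOrder g := by
    intro g
    by_contra hg
    have h2 : ¬ IsOfFinOrder (g ^ 2) := fun h => hg (h.of_pow (by norm_num))
    have hinj := injective_zpow_iff_not_isOfFinOrder.2 hg
    have hc := (htarski (Subgroup.zpowers (g ^ 2)) ?_ ?_).2
    · rw [Nat.card_zpowers] at hc
      exact h2 (orderOf_pos_iff.1 (hc ▸ hp.pos))
    · intro h
      rw [Subgroup.zpowers_eq_bot] at h
      exact h2 (h ▸ IsOfFinOrder.one)
    · intro h
      have hm : g ∈ Subgroup.zpowers (g ^ 2) := h ▸ Subgroup.mem_top g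
      obtain ⟨k, hk⟩ := Subgroup.mem_zpowers_iff.1 hm
      have : (2 * k : ℤ) = 1 := hinj (by
        simp only [zpow_one]
        rw [zpow_mul]
        exact_mod_cast hk)
      omega
  have hset : ∀ g : G, (Subgroup.zpowers g : Set G).Finite := fun g =>
    finite_zpowers.2 (hfin g)
  have htop : ∀ H : Subgroup G, (H : Set G).Finite → H ≠ ⊤ := by
    rintro H hH rfl
    exact Set.infinite_univ hH
  rw [eq_bot_iff]
  intro z hz
  rw [Subgroup.mem_bot]
  by_contra hz1
  have hzb : Subgroup.zpowers z ≠ ⊥ := fun h => hz1 (Subgroup.zpowers_eq_bot.1 h)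
  have hN : (Subgroup.zpowers z).Normal := by
    refine ⟨fun n hn g => ?_⟩
    have hnc : n ∈ Subgroup.center G := (Subgroup.zpowers_le.2 hz) hn
    rw [Subgroup.mem_center_iff.1 hnc g, mul_inv_cancel_right]
    exact hn
  obtain ⟨g, hg⟩ : ∃ g, g ∉ Subgroup.zpowers z := by
    by_contra! h
    exact htop _ (hset z) ((Subgroup.eq_top_iff' _).2 h)
  have hHfin : ((Subgroup.zpowers z ⊔ Subgroup.zpowers g : Subgroup G) : Set G).Finite := by
    rw [Subgroup.normal_mul]
    exact (hset z).mul (hset g)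
  have hle : Subgroup.zpowers z ≤ Subgroup.zpowers z ⊔ Subgroup.zpowers g := le_sup_left
  have h1 := (htarski _ hzb (htop _ (hset z))).2
  have h2 := (htarski _ (fun h => hzb (eq_bot_iff.2 (h ▸ hle))) (htop _ hHfin)).2
  have heq : (Subgroup.zpowers z : Set G) = (Subgroup.zpowers z ⊔ Subgroup.zpowers g : Subgroup G) :=
    Set.eq_of_subset_of_ncard_le hle (le_of_eq (h2.trans h1.symm)) hHfin
  apply hg
  have : g ∈ ((Subgroup.zpowers z ⊔ Subgroup.zpowers g : Subgroup G) : Set G) :=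
    (le_sup_right : Subgroup.zpowers g ≤ _) (Subgroup.mem_zpowers g)
  rw [← heq] at this
  exact this
end
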